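/- arXiv:1602.04895 — 3 statements merged into one kernel-verified Lean document; each statement's English description precedes it below -/
import Mathlib

section
/- For each vertex i of the Dynkin diagram, the assignments T_i(F_j)=F_j for j not adjacent to i, T_i(F_j)=F_jF_i − qF_iF_j for j adjacent to i, T_i(F_i)=−K_i^{-1}E_i; T_i(E_j)=E_j for j not adjacent, T_i(E_j)=E_iE_j − q^{-1}E_jE_i for j adjacent, T_i(E_i)=−F_iK_i; and T_i(K_j)=K_j for j not adjacent, T_i(K_j)=K_iK_j for j adjacent, T_i(K_i)=K_i^{-1}, extend to a well-defined ℚ(q)-algebra automorphism T_i of U_q(𝔤), and these automorphisms satisfy the braid relations: T_iT_jT_i = T_jT_iT_j when i and j are adjacent, and T_iT_j = T_jT_i when i and j are not adjacent. -/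
/-!
Common setup: the quantized universal enveloping algebra `U_q(𝔤)` of a simple
complex Lie algebra of type ADE, presented by the Chevalley generators
`E i`, `F i`, `K i`, `K i⁻¹` over `ℚ(q)`, together with the combinatorics of
words in the Weyl group, PBW root vectors and monomials, Lusztig's braid group
automorphisms, the bar involution, lattices, and partial orders on Lusztig data.
-/

noncomputable section

open scoped BigOperators

/-- The base field `ℚ(q)`. -/
abbrev 𝕂 : Type := RatFunc ℚ

/-- The indeterminate `q ∈ ℚ(q)`. -/
noncomputable def qq : 𝕂 := RatFunc.X

/-- The Cartan matrix attached to an adjacency function: `2` on the diagonal,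
`-1` for adjacent vertices, `0` otherwise. -/
def cartanOf {I : Type} [DecidableEq I] (adj : I → I → Bool) (i j : I) : ℤ :=
  if i = j then 2 else if adj i j then -1 else 0

/-- The datum of a simply laced (ADE) Dynkin diagram of a simple Lie algebra:
a finite nonempty vertex set with a symmetric irreflexive adjacency relation,
connected (simple `𝔤`), whose Cartan matrix is positive definite (finite type;
together with simply-lacedness this characterizes types A, D, E). -/
structure ADEData (I : Type) [Fintype I] [DecidableEq I] : Type where
  nonE : Nonempty I
  adj : I → I → Bool
  symm : ∀ i j, adj i j = adj j i
  irrefl : ∀ i, adj i i = false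
  conn : ∀ i j : I, Relation.ReflTransGen (fun a b => adj a b = true) i j
  posdef : ∀ v : I → ℚ, v ≠ 0 → 0 < ∑ i, ∑ j, (cartanOf adj i j : ℚ) * v i * v j

variable {I : Type} [Fintype I] [DecidableEq I]

/-- Generators `E i`, `F i`, `K i`, `K i⁻¹` of `U_q(𝔤)`. -/
inductive Gen (I : Type) : Type
  | E : I → Gen I
  | F : I → Gen I
  | K : I → Gen I
  | Kinv : I → Gen I

/-- The free `ℚ(q)`-algebra on the generators. -/
abbrev FA (I : Type) := FreeAlgebra 𝕂 (Gen I)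

def gE (i : I) : FA I := FreeAlgebra.ι 𝕂 (Gen.E i)
def gF (i : I) : FA I := FreeAlgebra.ι 𝕂 (Gen.F i)
def gK (i : I) : FA I := FreeAlgebra.ι 𝕂 (Gen.K i)
def gKinv (i : I) : FA I := FreeAlgebra.ι 𝕂 (Gen.Kinv i)

/-- The defining relations of `U_q(𝔤)` (type ADE). -/
inductive QRel (D : ADEData I) : FA I → FA I → Prop
  | KKinv (i : I) : QRel D (gK i * gKinv i) 1
  | KinvK (i : I) : QRel D (gKinv i * gK i) 1
  | KcommK (i j : I) : QRel D (gK i * gK j) (gK j * gK i)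
  | KEself (i : I) : QRel D (gK i * gE i * gKinv i) ((qq ^ 2) • gE i)
  | KFself (i : I) : QRel D (gK i * gF i * gKinv i) ((qq ^ 2)⁻¹ • gF i)
  | EFdiff (i j : I) (h : i ≠ j) : QRel D (gE i * gF j - gF j * gE i) 0
  | EFself (i : I) :
      QRel D (gE i * gF i - gF i * gE i) ((qq - qq⁻¹)⁻¹ • (gK i - gKinv i))
  | serreE (i j : I) (h : D.adj i j = true) :
      QRel D (gE i ^ 2 * gE j + gE j * gE i ^ 2) ((qq + qq⁻¹) • (gE i * gE j * gE i))
  | serreF (i j : I) (h : D.adj i j = true) :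
      QRel D (gF i ^ 2 * gF j + gF j * gF i ^ 2) ((qq + qq⁻¹) • (gF i * gF j * gF i))
  | KEadj (i j : I) (h : D.adj i j = true) :
      QRel D (gK i * gE j * gKinv i) (qq⁻¹ • gE j)
  | KFadj (i j : I) (h : D.adj i j = true) :
      QRel D (gK i * gF j * gKinv i) (qq • gF j)
  | EEfar (i j : I) (h : i ≠ j) (h' : D.adj i j = false) :
      QRel D (gE i * gE j) (gE j * gE i)
  | FFfar (i j : I) (h : i ≠ j) (h' : D.adj i j = false) :
      QRel D (gF i * gF j) (gF j * gF i)
  | KEfar (i j : I) (h : i ≠ j) (h' : D.adj i j = false) :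
      QRel D (gK i * gE j * gKinv i) (gE j)
  | KFfar (i j : I) (h : i ≠ j) (h' : D.adj i j = false) :
      QRel D (gK i * gF j * gKinv i) (gF j)

/-- The quantized universal enveloping algebra `U_q(𝔤)`. -/
abbrev Uq (D : ADEData I) := RingQuot (QRel D)

/-- The generator `E i` of `U_q(𝔤)`. -/
def EE (D : ADEData I) (i : I) : Uq D := RingQuot.mkAlgHom 𝕂 (QRel D) (gE i)
/-- The generator `F i` of `U_q(𝔤)`. -/
def FF (D : ADEData I) (i : I) : Uq D := RingQuot.mkAlgHom 𝕂 (QRel D) (gF i)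
/-- The generator `K i` of `U_q(𝔤)`. -/
def KK (D : ADEData I) (i : I) : Uq D := RingQuot.mkAlgHom 𝕂 (QRel D) (gK i)
/-- The generator `K i ⁻¹` of `U_q(𝔤)`. -/
def KKinv (D : ADEData I) (i : I) : Uq D := RingQuot.mkAlgHom 𝕂 (QRel D) (gKinv i)

/-- The quantum integer `[n] = q^{n-1} + q^{n-3} + ⋯ + q^{-n+1}`. -/
def qInt (n : ℕ) : 𝕂 := ∑ t ∈ Finset.range n, qq ^ ((n : ℤ) - 1 - 2 * (t : ℤ))

/-- The quantum factorial `[n]! = [n][n-1]⋯[2][1]`. -/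
def qFact (n : ℕ) : 𝕂 := ∏ t ∈ Finset.range n, qInt (t + 1)

/-- The `q`-divided power `X^{(n)} = X^n / [n]!`. -/
def dp {D : ADEData I} (x : Uq D) (n : ℕ) : Uq D := (qFact n)⁻¹ • x ^ n

/-- `U_q^-(𝔤)`: the subalgebra generated by the `F i`. -/
def Uminus (D : ADEData I) : Subalgebra 𝕂 (Uq D) :=
  Algebra.adjoin 𝕂 (Set.range (FF D))

/-- `U_q^{≥0}(𝔤)`: the subalgebra generated by the `E i` and `K i^{±1}`. -/
def Ugeq0 (D : ADEData I) : Subalgebra 𝕂 (Uq D) :=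
  Algebra.adjoin 𝕂 (Set.range (EE D) ∪ Set.range (KK D) ∪ Set.range (KKinv D))

/-- A family of algebra automorphisms `T i` is the family of Lusztig braid
automorphisms if it takes the prescribed values on all generators. -/
def IsLusztigAuts (D : ADEData I) (T : I → (Uq D ≃ₐ[𝕂] Uq D)) : Prop :=
  ∀ i j : I,
    (T i (FF D i) = -(KKinv D i * EE D i)) ∧
    (D.adj i j = true → T i (FF D j) = FF D j * FF D i - qq • (FF D i * FF D j)) ∧
    (i ≠ j → D.adj i j = false → T i (FF D j) = FF D j) ∧
    (T i (EE D i) = -(FF D i * KK D i)) ∧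
    (D.adj i j = true → T i (EE D j) = EE D i * EE D j - qq⁻¹ • (EE D j * EE D i)) ∧
    (i ≠ j → D.adj i j = false → T i (EE D j) = EE D j) ∧
    (T i (KK D i) = KKinv D i) ∧
    (D.adj i j = true → T i (KK D j) = KK D i * KK D j) ∧
    (i ≠ j → D.adj i j = false → T i (KK D j) = KK D j)

/-- The Cartan matrix of the diagram. -/
def cartan (D : ADEData I) : I → I → ℤ := cartanOf D.adj

/-- The simple root `α i`, as a vector in the root lattice `ℤ^I`. -/
def simpleRoot (i : I) : I → ℤ := fun j => if j = i then 1 else 0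

/-- The standard pairing `(v, α i)` on the root lattice. -/
def pairing (D : ADEData I) (v : I → ℤ) (i : I) : ℤ := ∑ j, v j * cartan D j i

/-- The simple reflection `s i` acting on the root lattice. -/
def sref (D : ADEData I) (i : I) (v : I → ℤ) : I → ℤ :=
  fun j => v j - pairing D v i * simpleRoot i j

/-- Action of a word `(i₁, …, i_N)` on the root lattice: `s_{i₁} ∘ ⋯ ∘ s_{i_N}`. -/
def wordAct (D : ADEData I) : List I → (I → ℤ) → (I → ℤ)
  | [] => fun v => v
  | i :: l => fun v => sref D i (wordAct D l v)

/-- A word in the generators of the Weyl group is reduced if no shorter word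
defines the same element (i.e., the same action on the root lattice). -/
def IsReducedWord (D : ADEData I) (w : List I) : Prop :=
  ∀ w' : List I, wordAct D w' = wordAct D w → w.length ≤ w'.length

/-- `w` is a reduced expression of the longest element `w₀` of the Weyl group. -/
def IsRedW0 (D : ADEData I) (w : List I) : Prop :=
  IsReducedWord D w ∧ ∀ w' : List I, IsReducedWord D w' → w'.length ≤ w.length

/-- The root `β_k = s_{i₁} ⋯ s_{i_{k-1}} (α_{i_k})` attached to the `k`-th letter
of the word `w` (here `k` is 0-indexed). -/
def beta (D : ADEData I) (w : List I) (k : Fin w.length) : I → ℤ :=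
  wordAct D (w.take k) (simpleRoot (w.get k))

/-- `v` is a root: it lies in the Weyl group orbit of a simple root. -/
def IsRoot (D : ADEData I) (v : I → ℤ) : Prop :=
  ∃ (l : List I) (i : I), v = wordAct D l (simpleRoot i)

/-- `v` is a positive root. -/
def IsPosRoot (D : ADEData I) (v : I → ℤ) : Prop :=
  IsRoot D v ∧ ∀ j, 0 ≤ v j

/-- Apply `T_{i₁} ∘ T_{i₂} ∘ ⋯ ∘ T_{i_m}` for a word `(i₁, …, i_m)`. -/
def applyT {D : ADEData I} (T : I → (Uq D ≃ₐ[𝕂] Uq D)) : List I → Uq D → Uq D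
  | [], x => x
  | i :: l, x => T i (applyT T l x)

/-- Apply `T_{i_m}^{-1} ∘ ⋯ ∘ T_{i₁}^{-1}` for a word `(i₁, …, i_m)`. -/
def applyTinv {D : ADEData I} (T : I → (Uq D ≃ₐ[𝕂] Uq D)) : List I → Uq D → Uq D
  | [], x => x
  | i :: l, x => applyTinv T l ((T i).symm x)

/-- The PBW root vector `F_{i;β_k} = T_{i₁} ⋯ T_{i_{k-1}} (F_{i_k})`
(`k` is 0-indexed). -/
def rootVec {D : ADEData I} (T : I → (Uq D ≃ₐ[𝕂] Uq D)) (w : List I)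
    (k : Fin w.length) : Uq D :=
  applyT T (w.take k) (FF D (w.get k))

/-- The PBW monomial `F^a = F_{β₁}^{(a₁)} F_{β₂}^{(a₂)} ⋯ F_{β_N}^{(a_N)}`
attached to the Lusztig datum `a`. -/
def pbw {D : ADEData I} (T : I → (Uq D ≃ₐ[𝕂] Uq D)) (w : List I)
    (a : Fin w.length → ℕ) : Uq D :=
  ((List.finRange w.length).map (fun k => dp (rootVec T w k) (a k))).prod

/-- `u` is a homogeneous element of weight `μ` for the root-lattice grading of
`U_q(𝔤)`: conjugation by `K i` multiplies it by `q^{(μ, α_i)}`. -/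
def HasWeight (D : ADEData I) (u : Uq D) (μ : I → ℤ) : Prop :=
  ∀ i, KK D i * u * KKinv D i = (qq ^ pairing D μ i) • u

/-- The weight `Σ_k a_k β_k` of a Lusztig datum. -/
def wtData (D : ADEData I) (w : List I) (a : Fin w.length → ℕ) : I → ℤ :=
  ∑ k, (a k : ℤ) • beta D w k

/-- `a` is less than `b` in the left lexicographic order on Lusztig data:
at the first index where they differ, `a` is **bigger**. -/
def LtLeft {N : ℕ} (a b : Fin N → ℕ) : Prop :=
  ∃ k, b k < a k ∧ ∀ l, l < k → a l = b l

/-- `a` is less than `b` in the right lexicographic order on Lusztig data: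
at the last index where they differ, `a` is **bigger**. -/
def LtRight {N : ℕ} (a b : Fin N → ℕ) : Prop :=
  ∃ k, b k < a k ∧ ∀ l, k < l → a l = b l

/-- The partial order `≺` on Lusztig data: same weight, and strictly smaller in
both lexicographic orders. -/
def Prec (D : ADEData I) (w : List I) (a b : Fin w.length → ℕ) : Prop :=
  wtData D w a = wtData D w b ∧ LtLeft a b ∧ LtRight a b

/-- Two words are related by a single braid move. -/
def BraidMove (D : ADEData I) (w w' : List I) : Prop :=
  (∃ (w₁ w₂ : List I) (a b : I), a ≠ b ∧ D.adj a b = false ∧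
      w = w₁ ++ a :: b :: w₂ ∧ w' = w₁ ++ b :: a :: w₂) ∨
  (∃ (w₁ w₂ : List I) (a b : I), D.adj a b = true ∧
      w = w₁ ++ a :: b :: a :: w₂ ∧ w' = w₁ ++ b :: a :: b :: w₂)

instance : Algebra (Polynomial ℤ) 𝕂 :=
  ((Polynomial.aeval qq : Polynomial ℤ →ₐ[ℤ] 𝕂)).toRingHom.toAlgebra

instance (D : ADEData I) : Module (Polynomial ℤ) (Uq D) :=
  Module.compHom _ (algebraMap (Polynomial ℤ) 𝕂)

/-- The `ℤ[q]`-lattice `𝓛` spanned by the PBW monomials of `B_i`. -/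
def latt {D : ADEData I} (T : I → (Uq D ≃ₐ[𝕂] Uq D)) (w : List I) :
    Submodule (Polynomial ℤ) (Uq D) :=
  Submodule.span (Polynomial ℤ) (Set.range (pbw T w))

/-- The sublattice `q𝓛`. -/
def qlatt {D : ADEData I} (T : I → (Uq D ≃ₐ[𝕂] Uq D)) (w : List I) :
    Submodule (Polynomial ℤ) (Uq D) :=
  Submodule.span (Polynomial ℤ) ((fun x => qq • x) '' ((latt T w : Submodule (Polynomial ℤ) (Uq D)) : Set (Uq D)))

/-- `bar` is the bar involution: the `ℚ`-algebra involution fixing `E i` and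
`F i`, sending `K i` to `K i⁻¹` and `q` to `q⁻¹`. -/
def IsBar (D : ADEData I) (bar : Uq D →+* Uq D) : Prop :=
  (∀ i, bar (EE D i) = EE D i) ∧ (∀ i, bar (FF D i) = FF D i) ∧
  (∀ i, bar (KK D i) = KKinv D i) ∧
  bar (algebraMap 𝕂 (Uq D) qq) = algebraMap 𝕂 (Uq D) qq⁻¹ ∧
  ∀ x, bar (bar x) = x

/-- `c ∈ ℚ(q)` is a Laurent polynomial in `q`. -/
def IsLaurent (c : 𝕂) : Prop :=
  ∃ (f : Polynomial ℚ) (m : ℕ), c = qq⁻¹ ^ m * Polynomial.aeval qq f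

/-- `b` is (an indexing of) the canonical basis: it lies in the lattice `𝓛`,
its residues mod `q𝓛` are the residues of the PBW monomials, and it is
bar-invariant. -/
def IsCanBasis {D : ADEData I} (T : I → (Uq D ≃ₐ[𝕂] Uq D)) (w : List I)
    (bar : Uq D →+* Uq D) (b : (Fin w.length → ℕ) → Uq D) : Prop :=
  (∀ a, b a ∈ latt T w) ∧ (∀ a, b a - pbw T w a ∈ qlatt T w) ∧ (∀ a, bar (b a) = b a)

/-- The braid move from `w` to `w'` does not change the relative position of the
roots `u` and `v` in the enumerations of positive roots attached to `w`, `w'`. -/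
def SameRelPos (D : ADEData I) (w w' : List I) (u v : I → ℤ) : Prop :=
  ∀ (k l : Fin w.length) (k' l' : Fin w'.length),
    beta D w k = u → beta D w l = v → beta D w' k' = u → beta D w' l' = v →
    ((k : ℕ) < (l : ℕ) ↔ (k' : ℕ) < (l' : ℕ))

/-- The subring `ℚ[q]₀ ⊆ ℚ(q)` of rational functions regular at `q = 0`. -/
def Reg0 : Subring 𝕂 where
  carrier := {x | ∃ f g : Polynomial ℚ, Polynomial.eval 0 g ≠ 0 ∧
    x * algebraMap (Polynomial ℚ) 𝕂 g = algebraMap (Polynomial ℚ) 𝕂 f}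
  zero_mem' := ⟨0, 1, by simp, by simp⟩
  one_mem' := ⟨1, 1, by simp, by simp⟩
  add_mem' := by
    rintro x y ⟨f1, g1, h1, e1⟩ ⟨f2, g2, h2, e2⟩
    refine ⟨f1 * g2 + f2 * g1, g1 * g2, by simpa using mul_ne_zero h1 h2, ?_⟩
    rw [map_mul, map_add, map_mul, map_mul, ← e1, ← e2]; ring
  mul_mem' := by
    rintro x y ⟨f1, g1, h1, e1⟩ ⟨f2, g2, h2, e2⟩
    refine ⟨f1 * f2, g1 * g2, by simpa using mul_ne_zero h1 h2, ?_⟩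
    rw [map_mul, map_mul, ← e1, ← e2]; ring
  neg_mem' := by
    rintro x ⟨f, g, h, e⟩
    exact ⟨-f, g, h, by rw [map_neg, ← e]; ring⟩

instance (D : ADEData I) : Module ↥Reg0 (Uq D) :=
  Module.compHom _ (Reg0.subtype)

/-- Iterated application of a family of operators along a word. -/
def applyOps {D : ADEData I} (Ft : I → Uq D → Uq D) : List I → Uq D → Uq D
  | [], x => x
  | i :: l, x => Ft i (applyOps Ft l x)

/-- Kashiwara's lattice `𝓛(∞)`: the `ℚ[q]₀`-span of all elements obtained from
`1` by applying sequences of the Kashiwara operators. -/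
def lattInf {D : ADEData I} (Ft : I → Uq D → Uq D) : Submodule ↥Reg0 (Uq D) :=
  Submodule.span ↥Reg0 {x : Uq D | ∃ l : List I, x = applyOps Ft l 1}

/-- The sublattice `q𝓛(∞)`. -/
def qlattInf {D : ADEData I} (Ft : I → Uq D → Uq D) : Submodule ↥Reg0 (Uq D) :=
  Submodule.span ↥Reg0 ((fun x => qq • x) '' ((lattInf Ft : Submodule ↥Reg0 (Uq D)) : Set (Uq D)))

end
set_option linter.unusedSimpArgs false
set_option linter.unusedVariables false
set_option linter.unusedSectionVars false
section
variable {k A : Type*} [Field k] [Ring A] [Algebra k A]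

theorem lq_rs {x y z : A} (h : x * y = z) (w : A) : x * (y * w) = z * w := by
  rw [← mul_assoc, h]

theorem lq_rs3 {x y t z : A} (h : x * (y * t) = z) (w : A) : x * (y * (t * w)) = z * w := by
  rw [← h]; simp only [mul_assoc]

-- EF, both adjacent, equal
theorem lq_EFaa {q : k} (hq : q ≠ 0) (hq2 : q ^ 2 - 1 ≠ 0) {e a f b K L Ka La : A}
    (hef : e * f = f * e + (q / (q ^ 2 - 1)) • (K - L))
    (hab : a * b = b * a + (q / (q ^ 2 - 1)) • (Ka - La))
    (heb : e * b = b * e) (haf : a * f = f * a)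
    (hKe : K * e = q ^ 2 • (e * K)) (hLe : L * e = (q⁻¹) ^ 2 • (e * L))
    (hKf : K * f = (q⁻¹) ^ 2 • (f * K)) (hLf : L * f = q ^ 2 • (f * L))
    (hKa : K * a = q⁻¹ • (a * K)) (hLa : L * a = q • (a * L))
    (hKb : K * b = q • (b * K)) (hLb : L * b = q⁻¹ • (b * L))
    (hKae : Ka * e = q⁻¹ • (e * Ka)) (hLae : La * e = q • (e * La))
    (hKaf : Ka * f = q • (f * Ka)) (hLaf : La * f = q⁻¹ • (f * La))
    (hKK : Ka * K = K * Ka) (hLL : La * L = L * La)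
    (hKL : Ka * L = L * Ka) (hLK : La * K = K * La) :
    (e * a - q⁻¹ • (a * e)) * (b * f - q • (f * b)) - (b * f - q • (f * b)) * (e * a - q⁻¹ • (a * e))
      = (q / (q ^ 2 - 1)) • (K * Ka - L * La) := by
  simp only [mul_add, add_mul, mul_sub, sub_mul, smul_mul_assoc, mul_smul_comm, smul_add, smul_sub,
    smul_smul, mul_assoc, hef, hab, heb, haf, hKe, hLe, hKf, hLf, hKa, hLa, hKb, hLb, hKae, hLae,
    hKaf, hLaf, hKK, hLL, hKL, hLK, lq_rs hef, lq_rs hab, lq_rs heb, lq_rs haf, lq_rs hKe, lq_rs hLe,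
    lq_rs hKf, lq_rs hLf, lq_rs hKa, lq_rs hLa, lq_rs hKb, lq_rs hLb, lq_rs hKae, lq_rs hLae, lq_rs hKaf, lq_rs hLaf]
  match_scalars <;> (try field_simp) <;> (try ring)

-- EF, both adjacent, different
theorem lq_EFab {q : k} (hq : q ≠ 0) {e a f b K L : A} {c : k}
    (hef : e * f = f * e + c • (K - L))
    (hab : a * b = b * a)
    (heb : e * b = b * e) (haf : a * f = f * a)
    (hKa : K * a = q⁻¹ • (a * K)) (hLa : L * a = q • (a * L))
    (hKb : K * b = q • (b * K)) (hLb : L * b = q⁻¹ • (b * L)) :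
    (e * a - q⁻¹ • (a * e)) * (b * f - q • (f * b)) - (b * f - q • (f * b)) * (e * a - q⁻¹ • (a * e))
      = 0 := by
  simp only [mul_add, add_mul, mul_sub, sub_mul, smul_mul_assoc, mul_smul_comm, smul_add, smul_sub,
    smul_smul, mul_assoc, hef, hab, heb, haf, hKa, hLa, hKb, hLb, lq_rs hef, lq_rs hab, lq_rs heb,
    lq_rs haf, lq_rs hKa, lq_rs hLa, lq_rs hKb, lq_rs hLb]
  match_scalars <;> (try field_simp) <;> (try ring)

-- EF, self with adjacent
theorem lq_EFib {q : k} (hq : q ≠ 0) {f b K : A}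
    (hKf : K * f = (q⁻¹) ^ 2 • (f * K))
    (hKb : K * b = q • (b * K))
    (hs : f ^ 2 * b + b * f ^ 2 = (q + q⁻¹) • (f * b * f)) :
    (-(f * K)) * (b * f - q • (f * b)) - (b * f - q • (f * b)) * (-(f * K)) = 0 := by
  have hs' := congrArg (fun x => x * K) hs
  simp only [pow_two, add_mul, smul_mul_assoc, mul_assoc] at hs'
  simp only [mul_add, add_mul, mul_sub, sub_mul, smul_mul_assoc, mul_smul_comm, smul_add, smul_sub,
    neg_mul, mul_neg, smul_smul, mul_assoc, hKf, hKb, lq_rs hKf, lq_rs hKb]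
  linear_combination (norm := skip) hs'
  match_scalars <;> (try field_simp) <;> (try ring)

-- Serre for (i, adjacent)
theorem lq_Serre_ib {q : k} (hq : q ≠ 0) (hq2 : q ^ 2 - 1 ≠ 0) {e a f K L : A}
    (hef : e * f = f * e + (q / (q ^ 2 - 1)) • (K - L))
    (haf : a * f = f * a) (hKL : K * L = 1) (hLK : L * K = 1)
    (hKe : K * e = q ^ 2 • (e * K)) (hLe : L * e = (q⁻¹) ^ 2 • (e * L))
    (hKf : K * f = (q⁻¹) ^ 2 • (f * K)) (hLf : L * f = q ^ 2 • (f * L))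
    (hKa : K * a = q⁻¹ • (a * K)) (hLa : L * a = q • (a * L)) :
    (-(f * K)) ^ 2 * (e * a - q⁻¹ • (a * e)) + (e * a - q⁻¹ • (a * e)) * (-(f * K)) ^ 2
      = (q + q⁻¹) • ((-(f * K)) * (e * a - q⁻¹ • (a * e)) * (-(f * K))) := by
  simp only [pow_two, mul_add, add_mul, mul_sub, sub_mul, smul_mul_assoc, mul_smul_comm, smul_add, smul_sub,
    neg_mul, mul_neg, neg_neg, smul_smul, mul_assoc, hef, haf, hKL, hLK, hKe, hLe, hKf, hLf, hKa, hLa,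
    lq_rs hef, lq_rs haf, lq_rs hKL, lq_rs hLK, lq_rs hKe, lq_rs hLe, lq_rs hKf, lq_rs hLf,
    lq_rs hKa, lq_rs hLa, mul_one, one_mul]
  match_scalars <;> (try field_simp) <;> (try ring)

-- Serre for (adjacent, i)
theorem lq_Serre_ai {q : k} (hq : q ≠ 0) (hq2 : q ^ 2 - 1 ≠ 0) {e a f K L : A}
    (hef : e * f = f * e + (q / (q ^ 2 - 1)) • (K - L))
    (haf : a * f = f * a) (hKL : K * L = 1) (hLK : L * K = 1)
    (hKe : K * e = q ^ 2 • (e * K)) (hLe : L * e = (q⁻¹) ^ 2 • (e * L))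
    (hKf : K * f = (q⁻¹) ^ 2 • (f * K)) (hLf : L * f = q ^ 2 • (f * L))
    (hKa : K * a = q⁻¹ • (a * K)) (hLa : L * a = q • (a * L))
    (hs : a ^ 2 * e + e * a ^ 2 = (q + q⁻¹) • (a * e * a)) :
    (e * a - q⁻¹ • (a * e)) ^ 2 * (-(f * K)) + (-(f * K)) * (e * a - q⁻¹ • (a * e)) ^ 2
      = (q + q⁻¹) • ((e * a - q⁻¹ • (a * e)) * (-(f * K)) * (e * a - q⁻¹ • (a * e))) := by
  have hs1 : e * (a * a) = (q + q⁻¹) • (a * (e * a)) - a * (a * e) := by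
    rw [eq_sub_iff_add_eq, ← mul_assoc a e a, ← hs]; simp only [pow_two, mul_assoc, add_comm]
  simp only [pow_two, mul_add, add_mul, mul_sub, sub_mul, smul_mul_assoc, mul_smul_comm, smul_add, smul_sub,
    neg_mul, mul_neg, neg_neg, smul_smul, mul_assoc, hef, haf, hKL, hLK, hKe, hLe, hKf, hLf, hKa, hLa,
    lq_rs hef, lq_rs haf, lq_rs hKL, lq_rs hLK, lq_rs hKe, lq_rs hLe, lq_rs hKf, lq_rs hLf,
    lq_rs hKa, lq_rs hLa, mul_one, one_mul, hs1, lq_rs3 hs1]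
  match_scalars <;> (try field_simp) <;> (try ring)

-- Serre for (adjacent, far)
theorem lq_Serre_ab {q : k} (hq : q ≠ 0) (hq2 : q ^ 2 + 1 ≠ 0) {e a b : A}
    (heb : e * b = b * e)
    (hs : e ^ 2 * a + a * e ^ 2 = (q + q⁻¹) • (e * a * e))
    (hb : a ^ 2 * b + b * a ^ 2 = (q + q⁻¹) • (a * b * a)) :
    (e * a - q⁻¹ • (a * e)) ^ 2 * b + b * (e * a - q⁻¹ • (a * e)) ^ 2
      = (q + q⁻¹) • ((e * a - q⁻¹ • (a * e)) * b * (e * a - q⁻¹ • (a * e))) := by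
  have hs1 : e * (e * a) = (q + q⁻¹) • (e * (a * e)) - a * (e * e) := by
    rw [eq_sub_iff_add_eq, ← mul_assoc e a e, ← hs]; simp only [pow_two, mul_assoc]
  have h1 := congrArg (fun x => e * (e * x)) hb
  have h2 := congrArg (fun x => e * x * e) hb
  have h3 := congrArg (fun x => x * e * e) hb
  simp only [pow_two, mul_add, add_mul, mul_sub, sub_mul, smul_mul_assoc, mul_smul_comm, smul_add, smul_sub,
    smul_smul, mul_assoc, heb, lq_rs heb, hs1, lq_rs3 hs1] at h1 h2 h3 ⊢
  linear_combination (norm := skip) (1/(q+q⁻¹)) • h1 - (1/(q+q⁻¹)*(1+q⁻¹^2)) • h2 + (1/(q+q⁻¹)*q⁻¹^2) • h3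
  match_scalars <;> (try field_simp) <;> (try ring)

-- EE for (adjacent, adjacent)
theorem lq_EEab {q : k} (hq : q ≠ 0) (hq2 : q ^ 2 + 1 ≠ 0) {e a b : A}
    (hab : a * b = b * a)
    (hs : e ^ 2 * a + a * e ^ 2 = (q + q⁻¹) • (e * a * e))
    (hb : e ^ 2 * b + b * e ^ 2 = (q + q⁻¹) • (e * b * e)) :
    (e * a - q⁻¹ • (a * e)) * (e * b - q⁻¹ • (b * e))
      = (e * b - q⁻¹ • (b * e)) * (e * a - q⁻¹ • (a * e)) := by
  have h1 := congrArg (fun x => b * x) hs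
  have h2 := congrArg (fun x => x * b) hs
  have h3 := congrArg (fun x => a * x) hb
  have h4 := congrArg (fun x => x * a) hb
  simp only [pow_two, mul_add, add_mul, mul_sub, sub_mul, smul_mul_assoc, mul_smul_comm, smul_add, smul_sub,
    smul_smul, mul_assoc, hab, lq_rs hab] at h1 h2 h3 h4 ⊢
  linear_combination (norm := skip) (-(1/(q+q⁻¹))) • h2 + (1/(q+q⁻¹)) • h4 - (q⁻¹^2/(q+q⁻¹)) • h3 + (q⁻¹^2/(q+q⁻¹)) • h1
  match_scalars <;> (try field_simp) <;> (try ring)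

-- inverse
theorem lq_TTE {q : k} (hq : q ≠ 0) (hq2 : q ^ 2 - 1 ≠ 0) {e a f K L : A}
    (hef : e * f = f * e + (q / (q ^ 2 - 1)) • (K - L))
    (haf : a * f = f * a) (hLK : L * K = 1)
    (hKe : K * e = q ^ 2 • (e * K))
    (hKa : K * a = q⁻¹ • (a * K)) (hLa : L * a = q • (a * L)) :
    (e * a - q⁻¹ • (a * e)) * (-(f * K)) - q⁻¹ • ((-(f * K)) * (e * a - q⁻¹ • (a * e))) = a := by
  simp only [pow_two, mul_add, add_mul, mul_sub, sub_mul, smul_mul_assoc, mul_smul_comm, smul_add, smul_sub,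
    neg_mul, mul_neg, neg_neg, smul_smul, mul_assoc, hef, haf, hLK, hKe, hKa, hLa, smul_neg,
    lq_rs hef, lq_rs haf, lq_rs hLK, lq_rs hKe,
    lq_rs hKa, lq_rs hLa, mul_one, one_mul]
  match_scalars <;> (try field_simp) <;> (try ring)
end
section
open MulOpposite
variable {I : Type} [Fintype I] [DecidableEq I] {k A : Type*} [Field k] [Ring A] [Algebra k A]

structure LSys (D : ADEData I) (q : k) (E F K L : I → A) : Prop where
  q0 : q ≠ 0
  q1 : q ^ 2 - 1 ≠ 0
  q2 : q ^ 2 + 1 ≠ 0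
  KL : ∀ i, K i * L i = 1
  LK : ∀ i, L i * K i = 1
  KK : ∀ i j, K i * K j = K j * K i
  KE : ∀ a b, K a * E b = q ^ (cartan D a b) • (E b * K a)
  KF : ∀ a b, K a * F b = q ^ (-cartan D a b) • (F b * K a)
  EF : ∀ a b, a ≠ b → E a * F b = F b * E a
  EFs : ∀ a, E a * F a = F a * E a + (q / (q ^ 2 - 1)) • (K a - L a)
  SE : ∀ a b, D.adj a b = true → E a ^ 2 * E b + E b * E a ^ 2 = (q + q⁻¹) • (E a * E b * E a)
  SF : ∀ a b, D.adj a b = true → F a ^ 2 * F b + F b * F a ^ 2 = (q + q⁻¹) • (F a * F b * F a)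
  EE : ∀ a b, a ≠ b → D.adj a b = false → E a * E b = E b * E a
  FF : ∀ a b, a ≠ b → D.adj a b = false → F a * F b = F b * F a

theorem lq_cself (D : ADEData I) (a : I) : cartan D a a = 2 := by simp [cartan, cartanOf]
theorem lq_adj_ne (D : ADEData I) {a b : I} (h : D.adj a b = true) : a ≠ b := by
  rintro rfl; simp [D.irrefl] at h
theorem lq_cadj (D : ADEData I) {a b : I} (h : D.adj a b = true) : cartan D a b = -1 := by
  simp [cartan, cartanOf, lq_adj_ne D h, h]
theorem lq_cfar (D : ADEData I) {a b : I} (hn : a ≠ b) (h : D.adj a b = false) : cartan D a b = 0 := by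
  simp [cartan, cartanOf, hn, h]
theorem lq_csymm (D : ADEData I) (a b : I) : cartan D a b = cartan D b a := by
  simp only [cartan, cartanOf, D.symm a b, eq_comm (a := a) (b := b)]

theorem lq_notri (D : ADEData I) {i a b : I} (h1 : D.adj i a = true) (h2 : D.adj i b = true)
    (h3 : D.adj a b = true) : False := by
  have n1 := lq_adj_ne D h1
  have n2 := lq_adj_ne D h2
  have n3 := lq_adj_ne D h3
  have h := D.posdef (Pi.single i 1 + Pi.single a 1 + Pi.single b 1) (by
    intro h; have := congrFun h i; simp [Pi.single_apply, n1, n2] at this)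
  have c : ∀ x y, cartanOf D.adj x y = cartan D x y := fun _ _ => rfl
  simp only [c, Pi.add_apply, mul_add, Finset.sum_add_distrib, Pi.single_apply, mul_ite, mul_one,
    mul_zero, ite_mul, zero_mul, Finset.sum_ite_eq', Finset.sum_ite_eq, Finset.mem_univ, if_true,
    add_mul, lq_cself, lq_cadj D h1, lq_cadj D h2, lq_cadj D h3, lq_csymm D a i,
    lq_csymm D b i, lq_csymm D b a] at h
  norm_num at h

/-- `K`-weight of an element. -/
def LWt (q : k) (K : I → A) (m : I → ℤ) (x : A) : Prop := ∀ a, K a * x = q ^ m a • (x * K a)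

theorem lq_inv_comm {q : k} (hq : q ≠ 0) {K L x : A} {m : ℤ} (h1 : K * L = 1) (h2 : L * K = 1)
    (h : K * x = q ^ m • (x * K)) : L * x = q ^ (-m) • (x * L) := by
  have : L * (K * x) * L = q ^ m • (L * (x * K) * L) := by rw [h]; simp
  rw [← mul_assoc, h2, one_mul, mul_assoc, mul_assoc, h1, mul_one] at this
  rw [this, smul_smul, ← zpow_add₀ hq]; simp

theorem lq_swap {q : k} (hq : q ≠ 0) {K x : A} {m : ℤ} (h : K * x = q ^ m • (x * K)) :
    x * K = q ^ (-m) • (K * x) := by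
  rw [h, smul_smul, ← zpow_add₀ hq]; simp

namespace LSys
variable {D : ADEData I} {q : k} {E F K L : I → A}

theorem LE (S : LSys D q E F K L) (a b : I) : L a * E b = q ^ (-cartan D a b) • (E b * L a) :=
  lq_inv_comm S.q0 (S.KL a) (S.LK a) (S.KE a b)
theorem LF (S : LSys D q E F K L) (a b : I) : L a * F b = q ^ (cartan D a b) • (F b * L a) := by
  have := lq_inv_comm S.q0 (S.KL a) (S.LK a) (S.KF a b)
  rwa [neg_neg] at this
theorem LKc (S : LSys D q E F K L) (a b : I) : L a * K b = K b * L a := by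
  have := lq_inv_comm (m := 0) S.q0 (S.KL a) (S.LK a) (by simpa using S.KK a b)
  simpa using this
theorem LLc (S : LSys D q E F K L) (a b : I) : L a * L b = L b * L a := by
  have := lq_inv_comm (m := 0) S.q0 (S.KL a) (S.LK a) (x := L b) (by simpa using (S.LKc b a).symm)
  simpa using this

theorem omega (S : LSys D q E F K L) : LSys (A := Aᵐᵒᵖ) D q⁻¹ (fun a => op (F a)) (fun a => op (E a))
    (fun a => op (L a)) (fun a => op (K a)) where
  q0 := inv_ne_zero S.q0
  q1 := by
    have := S.q0; have h1 := S.q1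
    intro h; apply h1; field_simp at h; linear_combination -h
  q2 := by
    have := S.q0; have h1 := S.q2
    intro h; apply h1; field_simp at h; linear_combination h
  KL i := by rw [← op_mul, S.KL]; rfl
  LK i := by rw [← op_mul, S.LK]; rfl
  KK i j := by rw [← op_mul, S.LLc, op_mul]
  KE a b := by
    have := lq_swap S.q0 (S.LF a b)
    simp only [← op_mul, ← op_smul, this, inv_zpow']
  KF a b := by
    have := lq_swap S.q0 (S.LE a b)
    simp only [← op_mul, ← op_smul, this, inv_zpow']
  EF a b h := by simp only [← op_mul, S.EF b a h.symm]
  EFs a := by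
    simp only [← op_mul, ← op_sub, ← op_smul, ← op_add]
    congr 1
    rw [S.EFs a]
    have := S.q0; have h1 := S.q1
    have h2 : q⁻¹ / (q⁻¹ ^ 2 - 1) = - (q / (q ^ 2 - 1)) := by
      have : (1:k) - q ^ 2 ≠ 0 := by intro h; apply h1; linear_combination -h
      have : q⁻¹ ^ 2 - 1 = (1 - q ^ 2) / q ^ 2 := by field_simp
      rw [this]; field_simp; ring
    rw [h2]; module
  SE a b h := by
    have := congrArg op (S.SF a b h)
    simp only [op_mul, op_add, op_smul, op_pow, inv_inv] at this ⊢
    rw [add_comm, this, add_comm, mul_assoc]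
  SF a b h := by
    have := congrArg op (S.SE a b h)
    simp only [op_mul, op_add, op_smul, op_pow, inv_inv] at this ⊢
    rw [add_comm, this, add_comm, mul_assoc]
  EE a b h h' := by simp only [← op_mul, S.FF a b h h']
  FF a b h h' := by simp only [← op_mul, S.EE a b h h']

theorem sigma (S : LSys D q E F K L) : LSys (A := Aᵐᵒᵖ) D q (fun a => op (E a)) (fun a => op (F a))
    (fun a => op (L a)) (fun a => op (K a)) where
  q0 := S.q0
  q1 := S.q1
  q2 := S.q2
  KL i := by rw [← op_mul, S.KL]; rfl
  LK i := by rw [← op_mul, S.LK]; rfl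
  KK i j := by rw [← op_mul, S.LLc, op_mul]
  KE a b := by
    have := lq_swap S.q0 (S.LE a b)
    simp only [← op_mul, ← op_smul, this, neg_neg]
  KF a b := by
    have := lq_swap S.q0 (S.LF a b)
    simp only [← op_mul, ← op_smul, this]
  EF a b h := by simp only [← op_mul, S.EF a b h]
  EFs a := by
    simp only [← op_mul, ← op_sub, ← op_smul, ← op_add]
    congr 1
    rw [S.EFs a]
    module
  SE a b h := by
    have := congrArg op (S.SE a b h)
    simp only [op_mul, op_add, op_smul, op_pow] at this ⊢
    rw [add_comm, this, mul_assoc]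
  SF a b h := by
    have := congrArg op (S.SF a b h)
    simp only [op_mul, op_add, op_smul, op_pow] at this ⊢
    rw [add_comm, this, mul_assoc]
  EE a b h h' := by simp only [← op_mul, S.EE a b h h']
  FF a b h h' := by simp only [← op_mul, S.FF a b h h']

end LSys
end
section
open MulOpposite
variable {I : Type} [Fintype I] [DecidableEq I] {k A : Type*} [Field k] [Ring A] [Algebra k A]

def lTE (D : ADEData I) (q : k) (E F K : I → A) (i a : I) : A :=
  if a = i then -(F i * K i) else if D.adj i a = true then E i * E a - q⁻¹ • (E a * E i) else E a
def lTF (D : ADEData I) (q : k) (E F L : I → A) (i a : I) : A :=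
  if a = i then -(L i * E i) else if D.adj i a = true then F a * F i - q • (F i * F a) else F a
def lTK (D : ADEData I) (K L : I → A) (i a : I) : A :=
  if a = i then L i else if D.adj i a = true then K i * K a else K a
def lTL (D : ADEData I) (K L : I → A) (i a : I) : A :=
  if a = i then K i else if D.adj i a = true then L a * L i else L a

theorem lTE_op (D : ADEData I) (q : k) (E F L : I → A) (i a : I) :
    lTE (A := Aᵐᵒᵖ) D q⁻¹ (fun a => op (F a)) (fun a => op (E a)) (fun a => op (L a)) i a
      = op (lTF D q E F L i a) := by
  unfold lTE lTF
  split_ifs <;> simp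
theorem lTF_op (D : ADEData I) (q : k) (E F K : I → A) (i a : I) :
    lTF (A := Aᵐᵒᵖ) D q⁻¹ (fun a => op (F a)) (fun a => op (E a)) (fun a => op (K a)) i a
      = op (lTE D q E F K i a) := by
  unfold lTE lTF
  split_ifs <;> simp
theorem lTK_op (D : ADEData I) (K L : I → A) (i a : I) :
    lTK (A := Aᵐᵒᵖ) D (fun a => op (L a)) (fun a => op (K a)) i a = op (lTL D K L i a) := by
  unfold lTK lTL
  split_ifs <;> simp
theorem lTL_op (D : ADEData I) (K L : I → A) (i a : I) :
    lTL (A := Aᵐᵒᵖ) D (fun a => op (L a)) (fun a => op (K a)) i a = op (lTK D K L i a) := by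
  unfold lTK lTL
  split_ifs <;> simp

theorem lTE_self (D : ADEData I) (q : k) (E F K : I → A) (i : I) :
    lTE D q E F K i i = -(F i * K i) := by simp [lTE]
theorem lTE_adj (D : ADEData I) (q : k) (E F K : I → A) {i a : I} (h : D.adj i a = true) :
    lTE D q E F K i a = E i * E a - q⁻¹ • (E a * E i) := by simp [lTE, (lq_adj_ne D h).symm, h]
theorem lTE_far (D : ADEData I) (q : k) (E F K : I → A) {i a : I} (hn : a ≠ i) (h : D.adj i a = false) :
    lTE D q E F K i a = E a := by simp [lTE, hn, h]
theorem lTF_self (D : ADEData I) (q : k) (E F L : I → A) (i : I) :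
    lTF D q E F L i i = -(L i * E i) := by simp [lTF]
theorem lTF_adj (D : ADEData I) (q : k) (E F L : I → A) {i a : I} (h : D.adj i a = true) :
    lTF D q E F L i a = F a * F i - q • (F i * F a) := by simp [lTF, (lq_adj_ne D h).symm, h]
theorem lTF_far (D : ADEData I) (q : k) (E F L : I → A) {i a : I} (hn : a ≠ i) (h : D.adj i a = false) :
    lTF D q E F L i a = F a := by simp [lTF, hn, h]
theorem lTK_self (D : ADEData I) (K L : I → A) (i : I) : lTK D K L i i = L i := by simp [lTK]
theorem lTK_adj (D : ADEData I) (K L : I → A) {i a : I} (h : D.adj i a = true) :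
    lTK D K L i a = K i * K a := by simp [lTK, (lq_adj_ne D h).symm, h]
theorem lTK_far (D : ADEData I) (K L : I → A) {i a : I} (hn : a ≠ i) (h : D.adj i a = false) :
    lTK D K L i a = K a := by simp [lTK, hn, h]
theorem lTL_self (D : ADEData I) (K L : I → A) (i : I) : lTL D K L i i = K i := by simp [lTL]
theorem lTL_adj (D : ADEData I) (K L : I → A) {i a : I} (h : D.adj i a = true) :
    lTL D K L i a = L a * L i := by simp [lTL, (lq_adj_ne D h).symm, h]
theorem lTL_far (D : ADEData I) (K L : I → A) {i a : I} (hn : a ≠ i) (h : D.adj i a = false) :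
    lTL D K L i a = L a := by simp [lTL, hn, h]

theorem lq_tri (D : ADEData I) (i a : I) :
    a = i ∨ D.adj i a = true ∨ (a ≠ i ∧ D.adj i a = false) := by
  by_cases h : a = i
  · exact Or.inl h
  · cases h' : D.adj i a
    · exact Or.inr (Or.inr ⟨h, rfl⟩)
    · exact Or.inr (Or.inl rfl)

namespace LWt
variable {q : k} {K : I → A} {m n : I → ℤ} {x y : A}
theorem mul (hq : q ≠ 0) (hx : LWt q K m x) (hy : LWt q K n y) : LWt q K (fun a => m a + n a) (x * y) := by
  intro a
  rw [← mul_assoc, hx a, smul_mul_assoc, mul_assoc, hy a, mul_smul_comm, smul_smul, zpow_add₀ hq, mul_assoc]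
theorem sub (hx : LWt q K m x) (hy : LWt q K m y) : LWt q K m (x - y) := by
  intro a
  rw [mul_sub, hx a, hy a, sub_mul, smul_sub]
theorem neg (hx : LWt q K m x) : LWt q K m (-x) := by
  intro a
  rw [mul_neg, hx a, neg_mul, smul_neg]
theorem smul (hx : LWt q K m x) (c : k) : LWt q K m (c • x) := by
  intro a
  rw [mul_smul_comm, hx a, smul_mul_assoc, smul_comm]
theorem congr (hx : LWt q K m x) (h : ∀ a, m a = n a) : LWt q K n x := by
  intro a; rw [← h, hx a]
end LWt

namespace LSys
variable {D : ADEData I} {q : k} {E F K L : I → A}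

theorem wtTE (S : LSys D q E F K L) (i b : I) :
    LWt q K (fun a => cartan D a b - cartan D i b * cartan D a i) (lTE D q E F K i b) := by
  have hE : ∀ b, LWt q K (fun a => cartan D a b) (E b) := fun b a => S.KE a b
  have hF : ∀ b, LWt q K (fun a => -cartan D a b) (F b) := fun b a => S.KF a b
  have hK : ∀ b, LWt q K (fun a => 0) (K b) := fun b a => by simpa using S.KK a b
  rcases lq_tri D i b with rfl | h | ⟨hn, h⟩
  · rw [lTE_self]
    refine (((hF b).mul S.q0 (hK b)).neg).congr fun a => ?_
    rw [lq_cself]; ring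
  · rw [lTE_adj D q E F K h]
    refine (((hE i).mul S.q0 (hE b)).sub ((((hE b).mul S.q0 (hE i)).congr fun a => add_comm _ _).smul _)).congr
      fun a => ?_
    rw [lq_cadj D h]; ring
  · rw [lTE_far D q E F K hn h]
    refine (hE b).congr fun a => ?_
    rw [lq_cfar D hn.symm h]; ring

theorem lq_lTK (S : LSys D q E F K L) (i a : I) {m : I → ℤ} {x : A} (hx : LWt q K m x) :
    lTK D K L i a * x = q ^ (m a - cartan D i a * m i) • (x * lTK D K L i a) := by
  rcases lq_tri D i a with rfl | h | ⟨hn, h⟩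
  · rw [lTK_self, lq_inv_comm S.q0 (S.KL a) (S.LK a) (hx a), lq_cself]
    congr 2; ring
  · rw [lTK_adj D K L h, mul_assoc, hx a, mul_smul_comm, ← mul_assoc, hx i, smul_mul_assoc, smul_smul,
      ← zpow_add₀ S.q0, lq_cadj D h, mul_assoc]
    congr 2; ring
  · rw [lTK_far D K L hn h, hx a, lq_cfar D hn.symm h]
    congr 2; ring

theorem T_KE (S : LSys D q E F K L) (i a b : I) :
    lTK D K L i a * lTE D q E F K i b = q ^ (cartan D a b) • (lTE D q E F K i b * lTK D K L i a) := by
  rw [S.lq_lTK i a (S.wtTE i b)]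
  congr 2
  rw [lq_cself, lq_csymm D a i]; ring

theorem T_KL (S : LSys D q E F K L) (i a : I) : lTK D K L i a * lTL D K L i a = 1 := by
  rcases lq_tri D i a with rfl | h | ⟨hn, h⟩
  · rw [lTK_self, lTL_self, S.LK]
  · rw [lTK_adj D K L h, lTL_adj D K L h, mul_assoc, lq_rs (S.KL a), one_mul, S.KL]
  · rw [lTK_far D K L hn h, lTL_far D K L hn h, S.KL]
theorem T_LK (S : LSys D q E F K L) (i a : I) : lTL D K L i a * lTK D K L i a = 1 := by
  rcases lq_tri D i a with rfl | h | ⟨hn, h⟩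
  · rw [lTK_self, lTL_self, S.KL]
  · rw [lTK_adj D K L h, lTL_adj D K L h, mul_assoc, lq_rs (S.LK i), one_mul, S.LK]
  · rw [lTK_far D K L hn h, lTL_far D K L hn h, S.LK]

theorem T_KK (S : LSys D q E F K L) (i a b : I) :
    lTK D K L i a * lTK D K L i b = lTK D K L i b * lTK D K L i a := by
  have h0 : LWt q K (fun a => 0) (lTK D K L i b) := by
    intro a
    rw [zpow_zero, one_smul]
    rcases lq_tri D i b with rfl | h | ⟨hn, h⟩
    · rw [lTK_self, S.LKc]
    · rw [lTK_adj D K L h, ← mul_assoc, S.KK a i, mul_assoc, S.KK a b, mul_assoc]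
    · rw [lTK_far D K L hn h, S.KK]
  simpa using S.lq_lTK i a h0

-- specialised rules
theorem KEs (S : LSys D q E F K L) (a : I) : K a * E a = q ^ 2 • (E a * K a) := by
  rw [S.KE, lq_cself]; norm_cast
theorem KFs (S : LSys D q E F K L) (a : I) : K a * F a = q⁻¹ ^ 2 • (F a * K a) := by
  rw [S.KF, lq_cself, inv_pow, zpow_neg]; norm_cast
theorem LEs (S : LSys D q E F K L) (a : I) : L a * E a = q⁻¹ ^ 2 • (E a * L a) := by
  rw [S.LE, lq_cself, inv_pow, zpow_neg]; norm_cast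
theorem LFs (S : LSys D q E F K L) (a : I) : L a * F a = q ^ 2 • (F a * L a) := by
  rw [S.LF, lq_cself]; norm_cast
theorem KEa (S : LSys D q E F K L) {a b : I} (h : D.adj a b = true) : K a * E b = q⁻¹ • (E b * K a) := by
  rw [S.KE, lq_cadj D h, zpow_neg_one]
theorem KFa (S : LSys D q E F K L) {a b : I} (h : D.adj a b = true) : K a * F b = q • (F b * K a) := by
  rw [S.KF, lq_cadj D h, neg_neg, zpow_one]
theorem LEa (S : LSys D q E F K L) {a b : I} (h : D.adj a b = true) : L a * E b = q • (E b * L a) := by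
  rw [S.LE, lq_cadj D h, neg_neg, zpow_one]
theorem LFa (S : LSys D q E F K L) {a b : I} (h : D.adj a b = true) : L a * F b = q⁻¹ • (F b * L a) := by
  rw [S.LF, lq_cadj D h, zpow_neg_one]
theorem KEf (S : LSys D q E F K L) {a b : I} (hn : a ≠ b) (h : D.adj a b = false) : K a * E b = E b * K a := by
  rw [S.KE, lq_cfar D hn h, zpow_zero, one_smul]
theorem KFf (S : LSys D q E F K L) {a b : I} (hn : a ≠ b) (h : D.adj a b = false) : K a * F b = F b * K a := by
  rw [S.KF, lq_cfar D hn h, neg_zero, zpow_zero, one_smul]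

theorem T_SE (S : LSys D q E F K L) (i a b : I) (hab : D.adj a b = true) :
    lTE D q E F K i a ^ 2 * lTE D q E F K i b + lTE D q E F K i b * lTE D q E F K i a ^ 2
      = (q + q⁻¹) • (lTE D q E F K i a * lTE D q E F K i b * lTE D q E F K i a) := by
  have hne := lq_adj_ne D hab
  rcases lq_tri D i a with rfl | ha | ⟨han, ha⟩
  · rw [lTE_self, lTE_adj D q E F K hab]
    exact lq_Serre_ib S.q0 S.q1 (S.EFs a) (S.EF _ _ hne.symm) (S.KL a) (S.LK a) (S.KEs a) (S.LEs a)
      (S.KFs a) (S.LFs a) (S.KEa hab) (S.LEa hab)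
  · rcases lq_tri D i b with rfl | hb | ⟨hbn, hb⟩
    · rw [lTE_self, lTE_adj D q E F K ha]
      exact lq_Serre_ai S.q0 S.q1 (S.EFs b) (S.EF _ _ hne) (S.KL b) (S.LK b) (S.KEs b) (S.LEs b)
        (S.KFs b) (S.LFs b) (S.KEa ha) (S.LEa ha) (S.SE a b hab)
    · exact (lq_notri D ha hb hab).elim
    · rw [lTE_adj D q E F K ha, lTE_far D q E F K hbn hb]
      exact lq_Serre_ab S.q0 S.q2 (S.EE _ _ hbn.symm hb) (S.SE _ _ ha) (S.SE _ _ hab)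
  · rcases lq_tri D i b with rfl | hb | ⟨hbn, hb⟩
    · rw [D.symm, ha] at hab; simp at hab
    · rw [lTE_far D q E F K han ha, lTE_adj D q E F K hb]
      have h1 : E i * E a = E a * E i := S.EE _ _ han.symm ha
      have hs := S.SE a b hab
      have e1 := congrArg (fun x => E i * x) hs
      have e2 := congrArg (fun x => x * E i) hs
      simp only [pow_two, mul_add, add_mul, mul_sub, sub_mul, smul_mul_assoc, mul_smul_comm, smul_add,
        smul_sub, smul_smul, mul_assoc, h1, lq_rs h1] at e1 e2 ⊢
      linear_combination (norm := module) e1 - q⁻¹ • e2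
    · rw [lTE_far D q E F K han ha, lTE_far D q E F K hbn hb]
      exact S.SE a b hab

theorem T_EE (S : LSys D q E F K L) (i a b : I) (hne : a ≠ b) (hab : D.adj a b = false) :
    lTE D q E F K i a * lTE D q E F K i b = lTE D q E F K i b * lTE D q E F K i a := by
  have c1 : ∀ a, a ≠ i → D.adj i a = false → lTE D q E F K i i * E a = E a * lTE D q E F K i i := by
    intro a hn h
    rw [lTE_self, neg_mul, mul_neg, mul_assoc, S.KEf hn.symm h, ← mul_assoc, ← S.EF a i hn, mul_assoc]
  have c2 : ∀ a b, D.adj i a = true → b ≠ i → D.adj i b = false → a ≠ b → D.adj a b = false →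
      lTE D q E F K i a * E b = E b * lTE D q E F K i a := by
    intro a b ha hbn hb hne hab
    have h1 := S.EE a b hne hab
    have h2 := S.EE i b hbn.symm hb
    rw [lTE_adj D q E F K ha]
    simp only [mul_sub, sub_mul, smul_mul_assoc, mul_smul_comm, mul_assoc, h1, h2, lq_rs h1, lq_rs h2]
  rcases lq_tri D i a with rfl | ha | ⟨han, ha⟩
  · rw [lTE_far D q E F K hne.symm hab, c1 b hne.symm hab]
  · rcases lq_tri D i b with rfl | hb | ⟨hbn, hb⟩
    · rw [D.symm, hab] at ha; simp at ha
    · rw [lTE_adj D q E F K ha, lTE_adj D q E F K hb]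
      exact lq_EEab S.q0 S.q2 (S.EE _ _ hne hab) (S.SE _ _ ha) (S.SE _ _ hb)
    · rw [lTE_far D q E F K hbn hb, c2 a b ha hbn hb hne hab]
  · rcases lq_tri D i b with rfl | hb | ⟨hbn, hb⟩
    · rw [lTE_far D q E F K han ha, c1 a han ha]
    · rw [lTE_far D q E F K han ha, c2 b a hb han ha hne.symm (by rw [D.symm, hab])]
    · rw [lTE_far D q E F K han ha, lTE_far D q E F K hbn hb, S.EE _ _ hne hab]

theorem T_EF1 (S : LSys D q E F K L) (i a b : I) (hne : a ≠ b) (ha : a = i ∨ D.adj i b = true) :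
    lTE D q E F K i a * lTF D q E F L i b = lTF D q E F L i b * lTE D q E F K i a := by
  rw [← sub_eq_zero]
  rcases ha with rfl | hb
  · rcases lq_tri D a b with rfl | hb | ⟨hbn, hb⟩
    · exact (hne rfl).elim
    · rw [lTE_self, lTF_adj D q E F L hb]
      exact lq_EFib S.q0 (S.KFs a) (S.KFa hb) (S.SF _ _ hb)
    · rw [lTE_self, lTF_far D q E F L hbn hb, neg_mul, mul_neg, mul_assoc, S.KFf hbn.symm hb, ← mul_assoc,
        S.FF a b hbn.symm hb, mul_assoc, sub_self]
  · rcases lq_tri D i a with rfl | ha | ⟨han, ha⟩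
    · rw [lTE_self, lTF_adj D q E F L hb]
      exact lq_EFib S.q0 (S.KFs a) (S.KFa hb) (S.SF _ _ hb)
    · rw [lTE_adj D q E F K ha, lTF_adj D q E F L hb]
      exact lq_EFab S.q0 (S.EFs i) (S.EF _ _ hne) (S.EF _ _ (lq_adj_ne D hb)) (S.EF _ _ (lq_adj_ne D ha).symm)
        (S.KEa ha) (S.LEa ha) (S.KFa hb) (S.LFa hb)
    · rw [lTE_far D q E F K han ha, lTF_adj D q E F L hb]
      have h1 := S.EF a b hne
      have h2 := S.EF a i han
      simp only [mul_sub, sub_mul, smul_mul_assoc, mul_smul_comm, mul_assoc, h1, h2, lq_rs h1, lq_rs h2]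
      simp

theorem T_EF (S : LSys D q E F K L) (i a b : I) (hne : a ≠ b) :
    lTE D q E F K i a * lTF D q E F L i b = lTF D q E F L i b * lTE D q E F K i a := by
  have key : (b = i ∨ D.adj i a = true) →
      lTE D q E F K i a * lTF D q E F L i b = lTF D q E F L i b * lTE D q E F K i a := by
    intro h
    have := S.omega.T_EF1 i b a hne.symm h
    rw [lTE_op, lTF_op, ← op_mul, ← op_mul] at this
    exact op_injective this
  rcases lq_tri D i a with ha | ha | ⟨han, ha⟩
  · exact S.T_EF1 i a b hne (Or.inl ha)
  · exact key (Or.inr ha)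
  · rcases lq_tri D i b with hb | hb | ⟨hbn, hb⟩
    · exact key (Or.inl hb)
    · exact S.T_EF1 i a b hne (Or.inr hb)
    · rw [lTE_far D q E F K han ha, lTF_far D q E F L hbn hb, S.EF a b hne]

theorem T_EFs (S : LSys D q E F K L) (i a : I) :
    lTE D q E F K i a * lTF D q E F L i a = lTF D q E F L i a * lTE D q E F K i a +
      (q / (q ^ 2 - 1)) • (lTK D K L i a - lTL D K L i a) := by
  rcases lq_tri D i a with rfl | ha | ⟨han, ha⟩
  · rw [lTE_self, lTF_self, lTK_self, lTL_self]
    have h1 : L a * E a * (F a * K a) = E a * F a := by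
      rw [S.LEs, ← mul_assoc, smul_mul_assoc, smul_mul_assoc, mul_assoc (E a), S.LFs, mul_smul_comm,
        smul_mul_assoc, smul_smul, mul_assoc, mul_assoc (F a), S.LK, mul_one]
      have : q⁻¹ ^ 2 * q ^ 2 = 1 := by rw [← mul_pow, inv_mul_cancel₀ S.q0, one_pow]
      rw [this, one_smul]
    rw [neg_mul_neg, neg_mul_neg, h1, mul_assoc, lq_rs (S.KL a), one_mul, S.EFs a]
    module
  · rw [lTE_adj D q E F K ha, lTF_adj D q E F L ha, lTK_adj D K L ha, lTL_adj D K L ha,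
      ← sub_eq_iff_eq_add', S.LLc a i]
    have ha' : D.adj a i = true := by rw [D.symm, ha]
    have hn := lq_adj_ne D ha
    exact lq_EFaa S.q0 S.q1 (S.EFs i) (S.EFs a) (S.EF _ _ hn) (S.EF _ _ hn.symm) (S.KEs i) (S.LEs i)
      (S.KFs i) (S.LFs i) (S.KEa ha) (S.LEa ha) (S.KFa ha) (S.LFa ha) (S.KEa ha') (S.LEa ha')
      (S.KFa ha') (S.LFa ha') (S.KK _ _) (S.LLc _ _) (S.LKc _ _).symm (S.LKc _ _)
  · rw [lTE_far D q E F K han ha, lTF_far D q E F L han ha, lTK_far D K L han ha, lTL_far D K L han ha,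
      S.EFs a]

theorem T (S : LSys D q E F K L) (i : I) :
    LSys D q (lTE D q E F K i) (lTF D q E F L i) (lTK D K L i) (lTL D K L i) where
  q0 := S.q0
  q1 := S.q1
  q2 := S.q2
  KL := S.T_KL i
  LK := S.T_LK i
  KK := S.T_KK i
  KE := S.T_KE i
  KF a b := by
    have := S.omega.T_KE i a b
    rw [lTE_op, lTK_op, ← op_mul, ← op_mul, ← op_smul] at this
    have := op_injective this
    have h2 := lq_inv_comm (m := cartan D a b) S.q0 (S.T_LK i a) (S.T_KL i a) (x := lTF D q E F L i b) (by
      rw [this, smul_smul, inv_zpow', ← zpow_add₀ S.q0]; simp)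
    exact h2
  EF := S.T_EF i
  EFs := S.T_EFs i
  SE := S.T_SE i
  SF a b h := by
    have := S.omega.T_SE i a b h
    simp only [lTE_op, ← op_mul, ← op_pow, ← op_add, ← op_smul, inv_inv] at this
    have := op_injective this
    rw [add_comm, this, add_comm, mul_assoc]
  EE := S.T_EE i
  FF a b h h' := by
    have := S.omega.T_EE i a b h h'
    simp only [lTE_op, ← op_mul] at this
    exact (op_injective this).symm

theorem TTE (S : LSys D q E F K L) {i a : I} (h : D.adj i a = true) :
    lTE D q E F K i a * lTE D q E F K i i - q⁻¹ • (lTE D q E F K i i * lTE D q E F K i a) = E a := by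
  rw [lTE_self, lTE_adj D q E F K h]
  exact lq_TTE S.q0 S.q1 (S.EFs i) (S.EF _ _ (lq_adj_ne D h).symm) (S.LK i) (S.KEs i) (S.KEa h) (S.LEa h)

theorem TTF (S : LSys D q E F K L) {i a : I} (h : D.adj i a = true) :
    lTF D q E F L i i * lTF D q E F L i a - q • (lTF D q E F L i a * lTF D q E F L i i) = F a := by
  have := S.omega.TTE h
  simp only [lTE_op, ← op_mul, ← op_sub, ← op_smul, inv_inv] at this
  exact op_injective this

end LSys
end
section
open MulOpposite
variable {I : Type} [Fintype I] [DecidableEq I]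

theorem lq_natpow_ne (c : ℚ) : (RatFunc.X : RatFunc ℚ) ^ 2 - RatFunc.C c ≠ 0 := by
  have h : (Polynomial.X ^ 2 - Polynomial.C c : Polynomial ℚ) ≠ 0 :=
    Polynomial.X_pow_sub_C_ne_zero (by norm_num) c
  intro h0
  apply h
  apply RatFunc.algebraMap_injective ℚ
  rw [map_sub, map_pow, RatFunc.algebraMap_X, RatFunc.algebraMap_C, map_zero, h0]

theorem lq_qq0 : qq ≠ 0 := RatFunc.X_ne_zero
theorem lq_qq1 : qq ^ 2 - 1 ≠ 0 := by simpa [qq] using lq_natpow_ne 1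
theorem lq_qq2 : qq ^ 2 + 1 ≠ 0 := by simpa [qq] using lq_natpow_ne (-1)

theorem lq_qqc : (qq - qq⁻¹)⁻¹ = qq / (qq ^ 2 - 1) := by
  have h0 := lq_qq0
  have h1 := lq_qq1
  have : qq - qq⁻¹ = (qq ^ 2 - 1) / qq := by field_simp
  rw [this, inv_div]

theorem lq_conj {A : Type*} [Ring A] [Algebra 𝕂 A] {K L x : A} {c : 𝕂} (h : L * K = 1) :
    K * x * L = c • x → K * x = c • (x * K) := by
  intro h'
  rw [← smul_mul_assoc, ← h', mul_assoc, h, mul_one]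

theorem lq_conj' {A : Type*} [Ring A] [Algebra 𝕂 A] {K L x : A} {c : 𝕂} (h : K * L = 1) :
    K * x = c • (x * K) → K * x * L = c • x := by
  intro h'
  rw [h', smul_mul_assoc, mul_assoc, h, mul_one]

theorem lq_n1 {A : Type*} [Ring A] {k l e : A} (h : k * l = 1) : -(k * -(l * e)) = e := by
  rw [mul_neg, neg_neg, ← mul_assoc, h, one_mul]
theorem lq_n2 {A : Type*} [Ring A] {k l f : A} (h : k * l = 1) : -(-(f * k) * l) = f := by
  rw [neg_mul, neg_neg, mul_assoc, h, mul_one]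
theorem lq_sideE {k A : Type*} [Field k] [Ring A] [Algebra k A] {ei ej ec : A} {c : k} (e4 : ej * ec = ec * ej) :
    ej * (ei * ec - c • (ec * ei)) - c • ((ei * ec - c • (ec * ei)) * ej) =
    (ej * ei - c • (ei * ej)) * ec - c • (ec * (ej * ei - c • (ei * ej))) := by
  simp only [mul_sub, sub_mul, smul_mul_assoc, mul_smul_comm, smul_sub, smul_smul, mul_assoc, e4, lq_rs e4]
  module
theorem lq_sideF {k A : Type*} [Field k] [Ring A] [Algebra k A] {ei ej ec : A} {c : k} (e4 : ej * ec = ec * ej) :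
    (ec * ei - c • (ei * ec)) * ej - c • (ej * (ec * ei - c • (ei * ec))) =
    ec * (ei * ej - c • (ej * ei)) - c • ((ei * ej - c • (ej * ei)) * ec) := by
  simp only [mul_sub, sub_mul, smul_mul_assoc, mul_smul_comm, smul_sub, smul_smul, mul_assoc, e4, lq_rs e4]
  module
theorem lq_bothE {k A : Type*} [Field k] [Ring A] [Algebra k A] {ei ej ec : A} {c : k} (e : ei * ej = ej * ei) :
    ej * (ei * ec - c • (ec * ei)) - c • ((ei * ec - c • (ec * ei)) * ej) =
    ei * (ej * ec - c • (ec * ej)) - c • ((ej * ec - c • (ec * ej)) * ei) := by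
  simp only [mul_sub, sub_mul, smul_mul_assoc, mul_smul_comm, smul_sub, smul_smul, mul_assoc, e, lq_rs e]
  module
theorem lq_bothF {k A : Type*} [Field k] [Ring A] [Algebra k A] {ei ej ec : A} {c : k} (e : ei * ej = ej * ei) :
    (ec * ei - c • (ei * ec)) * ej - c • (ej * (ec * ei - c • (ei * ec))) =
    (ec * ej - c • (ej * ec)) * ei - c • (ei * (ec * ej - c • (ej * ec))) := by
  simp only [mul_sub, sub_mul, smul_mul_assoc, mul_smul_comm, smul_sub, smul_smul, mul_assoc, e, lq_rs e]
  module

theorem lq_sysU (D : ADEData I) : LSys D qq (EE D) (FF D) (KK D) (KKinv D) := by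
  have R : ∀ {x y : FA I}, QRel D x y → RingQuot.mkAlgHom 𝕂 (QRel D) x = RingQuot.mkAlgHom 𝕂 (QRel D) y :=
    fun h => RingQuot.mkAlgHom_rel 𝕂 h
  have LK : ∀ i, KKinv D i * KK D i = 1 := fun i => by
    have := R (QRel.KinvK i); simp only [map_mul, map_one] at this; exact this
  refine ⟨lq_qq0, lq_qq1, lq_qq2, ?_, LK, ?_, ?_, ?_, ?_, ?_, ?_, ?_, ?_, ?_⟩
  · intro i; have := R (QRel.KKinv i); simp only [map_mul, map_one] at this; exact this
  · intro i j; have := R (QRel.KcommK i j); simp only [map_mul] at this; exact this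
  · intro a b
    apply lq_conj (LK a)
    rcases lq_tri D a b with rfl | h | ⟨hn, h⟩
    · rw [lq_cself]; have := R (QRel.KEself b); simp only [map_mul, map_smul] at this; exact this
    · rw [lq_cadj D h, zpow_neg_one]; have := R (QRel.KEadj a b h); simp only [map_mul, map_smul] at this; exact this
    · rw [lq_cfar D hn.symm h, zpow_zero, one_smul]
      have := R (QRel.KEfar a b hn.symm h); simp only [map_mul] at this; exact this
  · intro a b
    apply lq_conj (LK a)
    rcases lq_tri D a b with rfl | h | ⟨hn, h⟩
    · rw [lq_cself, zpow_neg]; have := R (QRel.KFself b); simp only [map_mul, map_smul] at this; exact this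
    · rw [lq_cadj D h, neg_neg, zpow_one]; have := R (QRel.KFadj a b h); simp only [map_mul, map_smul] at this; exact this
    · rw [lq_cfar D hn.symm h, neg_zero, zpow_zero, one_smul]
      have := R (QRel.KFfar a b hn.symm h); simp only [map_mul] at this; exact this
  · intro a b h
    have := R (QRel.EFdiff a b h)
    simp only [map_mul, map_sub, map_zero] at this; exact sub_eq_zero.mp this
  · intro a
    have := R (QRel.EFself a)
    simp only [map_mul, map_sub, map_smul, lq_qqc] at this; exact sub_eq_iff_eq_add'.mp this
  · intro a b h
    have := R (QRel.serreE a b h)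
    simp only [map_mul, map_add, map_smul, map_pow] at this; exact this
  · intro a b h
    have := R (QRel.serreF a b h)
    simp only [map_mul, map_add, map_smul, map_pow] at this; exact this
  · intro a b h h'
    have := R (QRel.EEfar a b h h')
    simp only [map_mul] at this; exact this
  · intro a b h h'
    have := R (QRel.FFfar a b h h')
    simp only [map_mul] at this; exact this

def lqGen {A : Type*} (E F K L : I → A) : Gen I → A
  | Gen.E i => E i
  | Gen.F i => F i
  | Gen.K i => K i
  | Gen.Kinv i => L i

theorem lq_lift {A : Type*} [Ring A] [Algebra 𝕂 A] {D : ADEData I} {E F K L : I → A}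
    (S : LSys D qq E F K L) : ∃ f : Uq D →ₐ[𝕂] A,
      (∀ i, f (EE D i) = E i) ∧ (∀ i, f (FF D i) = F i) ∧ (∀ i, f (KK D i) = K i) ∧
      (∀ i, f (KKinv D i) = L i) := by
  let g : FA I →ₐ[𝕂] A := FreeAlgebra.lift 𝕂 (lqGen E F K L)
  have gE' : ∀ i, g (gE i) = E i := fun i => by simp [g, gE, lqGen]
  have gF' : ∀ i, g (gF i) = F i := fun i => by simp [g, gF, lqGen]
  have gK' : ∀ i, g (gK i) = K i := fun i => by simp [g, gK, lqGen]
  have gL' : ∀ i, g (gKinv i) = L i := fun i => by simp [g, gKinv, lqGen]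
  have hg : ∀ ⦃x y : FA I⦄, QRel D x y → g x = g y := by
    intro x y h
    cases h with
    | KKinv i => simp only [map_mul, map_one, gK', gL', S.KL]
    | KinvK i => simp only [map_mul, map_one, gK', gL', S.LK]
    | KcommK i j => simp only [map_mul, gK', S.KK i j]
    | KEself i =>
      simp only [map_mul, map_smul, gK', gE', gL']
      exact lq_conj' (S.KL i) (S.KEs i)
    | KFself i =>
      simp only [map_mul, map_smul, gK', gF', gL']
      rw [← inv_pow]
      exact lq_conj' (S.KL i) (S.KFs i)
    | EFdiff i j h => simp only [map_mul, map_sub, map_zero, gE', gF', S.EF i j h, sub_self]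
    | EFself i =>
      simp only [map_mul, map_sub, map_smul, gE', gF', gK', gL', lq_qqc, S.EFs i, add_sub_cancel_left]
    | serreE i j h => simpa only [map_mul, map_add, map_smul, map_pow, gE'] using S.SE i j h
    | serreF i j h => simpa only [map_mul, map_add, map_smul, map_pow, gF'] using S.SF i j h
    | KEadj i j h =>
      simp only [map_mul, map_smul, gK', gE', gL']
      exact lq_conj' (S.KL i) (S.KEa h)
    | KFadj i j h =>
      simp only [map_mul, map_smul, gK', gF', gL']
      exact lq_conj' (S.KL i) (S.KFa h)
    | EEfar i j h h' => simp only [map_mul, gE', S.EE i j h h']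
    | FFfar i j h h' => simp only [map_mul, gF', S.FF i j h h']
    | KEfar i j h h' => 
      simp only [map_mul, gK', gE', gL']
      rw [S.KEf h h', mul_assoc, S.KL, mul_one]
    | KFfar i j h h' => 
      simp only [map_mul, gK', gF', gL']
      rw [S.KFf h h', mul_assoc, S.KL, mul_one]
  refine ⟨RingQuot.liftAlgHom 𝕂 ⟨g, hg⟩, ?_, ?_, ?_, ?_⟩
  · intro i; rw [EE, RingQuot.liftAlgHom_mkAlgHom_apply, gE']
  · intro i; rw [FF, RingQuot.liftAlgHom_mkAlgHom_apply, gF']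
  · intro i; rw [KK, RingQuot.liftAlgHom_mkAlgHom_apply, gK']
  · intro i; rw [KKinv, RingQuot.liftAlgHom_mkAlgHom_apply, gL']

theorem lq_ext {A : Type*} [Ring A] [Algebra 𝕂 A] {D : ADEData I} {f g : Uq D →ₐ[𝕂] A}
    (hE : ∀ i, f (EE D i) = g (EE D i)) (hF : ∀ i, f (FF D i) = g (FF D i))
    (hK : ∀ i, f (KK D i) = g (KK D i)) : f = g := by
  have hL : ∀ i, f (KKinv D i) = g (KKinv D i) := by
    intro i
    have h1 : f (KKinv D i) * f (KK D i) = 1 := by rw [← map_mul, (lq_sysU D).LK, map_one]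
    have h2 : g (KK D i) * g (KKinv D i) = 1 := by rw [← map_mul, (lq_sysU D).KL, map_one]
    exact left_inv_eq_right_inv h1 (by rw [hK, h2])
  apply RingQuot.ringQuot_ext' 𝕂
  apply FreeAlgebra.hom_ext
  funext x
  cases x with
  | E i => exact hE i
  | F i => exact hF i
  | K i => exact hK i
  | Kinv i => exact hL i

theorem lq_sigma (D : ADEData I) : ∃ s : Uq D → Uq D, ∃ σ : Uq D →ₐ[𝕂] (Uq D)ᵐᵒᵖ,
    (∀ x, σ x = op (s x)) ∧ (∀ x, s (s x) = x) ∧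
    (∀ i, s (EE D i) = EE D i) ∧ (∀ i, s (FF D i) = FF D i) ∧ (∀ i, s (KK D i) = KKinv D i) ∧
      (∀ i, s (KKinv D i) = KK D i) := by
  obtain ⟨σ, h1, h2, h3, h4⟩ := lq_lift (lq_sysU D).sigma
  have h : (AlgHom.opComm σ).comp σ = AlgHom.id 𝕂 (Uq D) := by
    apply lq_ext <;> intro i <;> simp [h1, h2, h3, h4]
  refine ⟨fun x => unop (σ x), σ, fun x => rfl, fun x => ?_, ?_, ?_, ?_, ?_⟩
  · exact DFunLike.congr_fun h x
  all_goals intro i; simp [h1, h2, h3, h4]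

theorem lq_T (D : ADEData I) (i : I) : ∃ T : Uq D ≃ₐ[𝕂] Uq D,
    (∀ a, T (EE D a) = lTE D qq (EE D) (FF D) (KK D) i a) ∧
    (∀ a, T (FF D a) = lTF D qq (EE D) (FF D) (KKinv D) i a) ∧
    (∀ a, T (KK D a) = lTK D (KK D) (KKinv D) i a) ∧
    (∀ a, T (KKinv D a) = lTL D (KK D) (KKinv D) i a) := by
  have S := lq_sysU D
  obtain ⟨T, hE, hF, hK, hL⟩ := lq_lift (S.T i)
  obtain ⟨s, σ, hσ, hss, sE, sF, sK, sL⟩ := lq_sigma D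
  have smul : ∀ x y, s (x * y) = s y * s x := by
    intro x y; apply op_injective; rw [← hσ, map_mul, hσ, hσ, op_mul]
  have ssub : ∀ x y, s (x - y) = s x - s y := by
    intro x y; apply op_injective; rw [← hσ, map_sub, hσ, hσ, op_sub]
  have sneg : ∀ x, s (-x) = - s x := by
    intro x; apply op_injective; rw [← hσ, map_neg, hσ, op_neg]
  have ssm : ∀ (c : 𝕂) x, s (c • x) = c • s x := by
    intro c x; apply op_injective; rw [← hσ, map_smul, hσ, op_smul]
  let T' : Uq D →ₐ[𝕂] Uq D := (AlgHom.opComm σ).comp ((AlgHom.op T).comp σ)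
  have hT' : ∀ x, T' x = s (T (s x)) := by
    intro x
    have : T' x = unop (σ (T (unop (σ x)))) := rfl
    rw [this, hσ, hσ, unop_op, unop_op]
  have h1 : T.comp T' = AlgHom.id 𝕂 (Uq D) := by
    apply lq_ext
    · intro a
      rw [AlgHom.comp_apply, hT', sE, hE, AlgHom.id_apply]
      rcases lq_tri D i a with rfl | h | ⟨hn, h⟩
      · rw [lTE_self, sneg, smul, sK, sF, map_neg, map_mul, hL, hF, lTL_self, lTF_self]
        exact lq_n1 (S.KL a)
      · rw [lTE_adj _ _ _ _ _ h, ssub, ssm, smul, smul, sE, sE, map_sub, map_smul, map_mul, map_mul, hE, hE]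
        exact S.TTE h
      · rw [lTE_far _ _ _ _ _ hn h, sE, hE, lTE_far _ _ _ _ _ hn h]
    · intro a
      rw [AlgHom.comp_apply, hT', sF, hF, AlgHom.id_apply]
      rcases lq_tri D i a with rfl | h | ⟨hn, h⟩
      · rw [lTF_self, sneg, smul, sL, sE, map_neg, map_mul, hE, hK, lTE_self, lTK_self]
        exact lq_n2 (S.KL a)
      · rw [lTF_adj _ _ _ _ _ h, ssub, ssm, smul, smul, sF, sF, map_sub, map_smul, map_mul, map_mul, hF, hF]
        exact S.TTF h
      · rw [lTF_far _ _ _ _ _ hn h, sF, hF, lTF_far _ _ _ _ _ hn h]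
    · intro a
      rw [AlgHom.comp_apply, hT', sK, hL, AlgHom.id_apply]
      rcases lq_tri D i a with rfl | h | ⟨hn, h⟩
      · rw [lTL_self, sK, hL, lTL_self]
      · rw [lTL_adj _ _ _ h, smul, sL, sL, map_mul, hK, hK, lTK_self, lTK_adj _ _ _ h, lq_rs (S.LK i), one_mul]
      · rw [lTL_far _ _ _ hn h, sL, hK, lTK_far _ _ _ hn h]
  have h1' : ∀ x, T (s (T (s x))) = x := by
    intro x; rw [← hT']; exact DFunLike.congr_fun h1 x
  have h2 : T'.comp T = AlgHom.id 𝕂 (Uq D) := by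
    apply AlgHom.ext
    intro x
    have := h1' (s x)
    rw [hss] at this
    rw [AlgHom.comp_apply, hT', this, hss, AlgHom.id_apply]
  exact ⟨AlgEquiv.ofAlgHom T T' h1 h2, hE, hF, hK, hL⟩
end
/-- Lusztig's assignments on the Chevalley generators extend to
well-defined `ℚ(q)`-algebra automorphisms `T i` of `U_q(𝔤)`, and these
automorphisms satisfy the braid relations. -/
theorem lusztig_braid_automorphisms_exist {I : Type} [Fintype I] [DecidableEq I]
    (D : ADEData I) :
    ∃ T : I → (Uq D ≃ₐ[𝕂] Uq D), IsLusztigAuts D T ∧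
      (∀ i j : I, D.adj i j = true →
        ∀ x : Uq D, T i (T j (T i x)) = T j (T i (T j x))) ∧
      (∀ i j : I, i ≠ j → D.adj i j = false →
        ∀ x : Uq D, T i (T j x) = T j (T i x)) := by
  choose T hE hF hK hL using lq_T D
  have S := lq_sysU D
  have ne := fun {a b} (h : D.adj a b = true) => lq_adj_ne D h
  -- key: T_i T_j x_i = x_j
  have kE : ∀ i j, D.adj i j = true → T i (T j (EE D i)) = EE D j := by
    intro i j h
    have h' : D.adj j i = true := by rw [D.symm, h]
    rw [hE, lTE_adj _ _ _ _ _ h', map_sub, map_smul, map_mul, map_mul, hE, hE]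
    exact S.TTE h
  have kF : ∀ i j, D.adj i j = true → T i (T j (FF D i)) = FF D j := by
    intro i j h
    have h' : D.adj j i = true := by rw [D.symm, h]
    rw [hF, lTF_adj _ _ _ _ _ h', map_sub, map_smul, map_mul, map_mul, hF, hF]
    exact S.TTF h
  have kK : ∀ i j, D.adj i j = true → T i (T j (KK D i)) = KK D j := by
    intro i j h
    have h' : D.adj j i = true := by rw [D.symm, h]
    rw [hK, lTK_adj _ _ _ h', map_mul, hK, hK, lTK_self, lTK_adj _ _ _ h, S.KK i j, mul_assoc, S.KL, mul_one]
  have kL : ∀ i j, D.adj i j = true → T i (T j (KKinv D i)) = KKinv D j := by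
    intro i j h
    have h' : D.adj j i = true := by rw [D.symm, h]
    rw [hL, lTL_adj _ _ _ h', map_mul, hL, hL, lTL_self, lTL_adj _ _ _ h, S.LLc j i, ← mul_assoc, S.KL, one_mul]
  refine ⟨T, ?_, ?_, ?_⟩
  · intro i j
    refine ⟨by rw [hF, lTF_self], fun h => by rw [hF, lTF_adj _ _ _ _ _ h],
      fun hn h => by rw [hF, lTF_far _ _ _ _ _ hn.symm h], by rw [hE, lTE_self],
      fun h => by rw [hE, lTE_adj _ _ _ _ _ h], fun hn h => by rw [hE, lTE_far _ _ _ _ _ hn.symm h],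
      by rw [hK, lTK_self], fun h => by rw [hK, lTK_adj _ _ _ h],
      fun hn h => by rw [hK, lTK_far _ _ _ hn.symm h]⟩
  · -- one-sided statements
    have self : ∀ i j, D.adj i j = true →
        T i (T j (T i (EE D i))) = T j (T i (T j (EE D i))) ∧
        T i (T j (T i (FF D i))) = T j (T i (T j (FF D i))) ∧
        T i (T j (T i (KK D i))) = T j (T i (T j (KK D i))) := by
      intro i j h
      refine ⟨?_, ?_, ?_⟩
      · rw [kE i j h, hE i i, hE j j, lTE_self, lTE_self, map_neg, map_neg, map_mul, map_mul, kF i j h, kK i j h]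
      · rw [kF i j h, hF i i, hF j j, lTF_self, lTF_self, map_neg, map_neg, map_mul, map_mul, kL i j h, kE i j h]
      · rw [kK i j h, hK i i, hK j j, lTK_self, lTK_self, kL i j h]
    have side : ∀ i j c, D.adj i j = true → D.adj i c = true → c ≠ j → D.adj j c = false →
        T i (T j (T i (EE D c))) = T j (T i (T j (EE D c))) ∧
        T i (T j (T i (FF D c))) = T j (T i (T j (FF D c))) ∧
        T i (T j (T i (KK D c))) = T j (T i (T j (KK D c))) := by
      intro i j c h hc hn hj
      have h' : D.adj j i = true := by rw [D.symm, h]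
      refine ⟨?_, ?_, ?_⟩
      · have e1 : T j (EE D c) = EE D c := by rw [hE, lTE_far _ _ _ _ _ hn hj]
        have e2 : T i (EE D c) = EE D i * EE D c - qq⁻¹ • (EE D c * EE D i) := by
          rw [hE, lTE_adj _ _ _ _ _ hc]
        have e3 : T j (EE D i) = EE D j * EE D i - qq⁻¹ • (EE D i * EE D j) := by
          rw [hE, lTE_adj _ _ _ _ _ h']
        have e4 := S.EE j c hn.symm hj
        rw [e1, e2, map_sub, map_sub, map_smul, map_smul, map_mul, map_mul, map_mul, map_mul,
          kE i j h, e1, e2, e3]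
        exact lq_sideE e4
      · have e1 : T j (FF D c) = FF D c := by rw [hF, lTF_far _ _ _ _ _ hn hj]
        have e2 : T i (FF D c) = FF D c * FF D i - qq • (FF D i * FF D c) := by
          rw [hF, lTF_adj _ _ _ _ _ hc]
        have e3 : T j (FF D i) = FF D i * FF D j - qq • (FF D j * FF D i) := by
          rw [hF, lTF_adj _ _ _ _ _ h']
        have e4 := S.FF j c hn.symm hj
        rw [e1, e2, map_sub, map_sub, map_smul, map_smul, map_mul, map_mul, map_mul, map_mul,
          kF i j h, e1, e2, e3]
        exact lq_sideF e4
      · have e1 : T j (KK D c) = KK D c := by rw [hK, lTK_far _ _ _ hn hj]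
        have e2 : T i (KK D c) = KK D i * KK D c := by rw [hK, lTK_adj _ _ _ hc]
        have e3 : T j (KK D i) = KK D j * KK D i := by rw [hK, lTK_adj _ _ _ h']
        rw [e1, e2, map_mul, map_mul, kK i j h, e1, e2, e3, mul_assoc]
    have all : ∀ i j c, D.adj i j = true →
        T i (T j (T i (EE D c))) = T j (T i (T j (EE D c))) ∧
        T i (T j (T i (FF D c))) = T j (T i (T j (FF D c))) ∧
        T i (T j (T i (KK D c))) = T j (T i (T j (KK D c))) := by
      intro i j c h
      have h' : D.adj j i = true := by rw [D.symm, h]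
      rcases lq_tri D i c with rfl | hc | ⟨hcn, hc⟩
      · exact self c j h
      · rcases lq_tri D j c with rfl | hj | ⟨hjn, hj⟩
        · obtain ⟨a, b, c⟩ := self c i h'
          exact ⟨a.symm, b.symm, c.symm⟩
        · exact (lq_notri D h hc hj).elim
        · exact side i j c h hc hjn hj
      · rcases lq_tri D j c with rfl | hj | ⟨hjn, hj⟩
        · rw [h] at hc; simp at hc
        · obtain ⟨a, b, c⟩ := side j i c h' hj hcn hc
          exact ⟨a.symm, b.symm, c.symm⟩
        · have a1 : T i (EE D c) = EE D c := by rw [hE, lTE_far _ _ _ _ _ hcn hc]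
          have a2 : T j (EE D c) = EE D c := by rw [hE, lTE_far _ _ _ _ _ hjn hj]
          have b1 : T i (FF D c) = FF D c := by rw [hF, lTF_far _ _ _ _ _ hcn hc]
          have b2 : T j (FF D c) = FF D c := by rw [hF, lTF_far _ _ _ _ _ hjn hj]
          have c1 : T i (KK D c) = KK D c := by rw [hK, lTK_far _ _ _ hcn hc]
          have c2 : T j (KK D c) = KK D c := by rw [hK, lTK_far _ _ _ hjn hj]
          exact ⟨by rw [a1, a2, a1, a2], by rw [b1, b2, b1, b2], by rw [c1, c2, c1, c2]⟩
    intro i j h x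
    have : ((T i).toAlgHom.comp ((T j).toAlgHom.comp (T i).toAlgHom)) =
        ((T j).toAlgHom.comp ((T i).toAlgHom.comp (T j).toAlgHom)) :=
      lq_ext (fun c => (all i j c h).1) (fun c => (all i j c h).2.1) (fun c => (all i j c h).2.2)
    exact DFunLike.congr_fun this x
  · have half : ∀ i j c, i ≠ j → D.adj i j = false → (c = i ∨ (c ≠ j ∧ D.adj j c = false)) →
        T i (T j (EE D c)) = T j (T i (EE D c)) ∧
        T i (T j (FF D c)) = T j (T i (FF D c)) ∧
        T i (T j (KK D c)) = T j (T i (KK D c)) := by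
      intro i j c hn h hc
      have h' : D.adj j i = false := by rw [D.symm, h]
      have hj : c ≠ j ∧ D.adj j c = false := by
        rcases hc with rfl | hc
        · exact ⟨hn, h'⟩
        · exact hc
      have a1 : T j (EE D i) = EE D i := by rw [hE, lTE_far _ _ _ _ _ hn h']
      have b1 : T j (FF D i) = FF D i := by rw [hF, lTF_far _ _ _ _ _ hn h']
      have c1 : T j (KK D i) = KK D i := by rw [hK, lTK_far _ _ _ hn h']
      have d1 : T j (KKinv D i) = KKinv D i := by rw [hL, lTL_far _ _ _ hn h']
      have a2 : T j (EE D c) = EE D c := by rw [hE, lTE_far _ _ _ _ _ hj.1 hj.2]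
      have b2 : T j (FF D c) = FF D c := by rw [hF, lTF_far _ _ _ _ _ hj.1 hj.2]
      have c2 : T j (KK D c) = KK D c := by rw [hK, lTK_far _ _ _ hj.1 hj.2]
      rw [a2, b2, c2, hE, hF, hK]
      unfold lTE lTF lTK
      refine ⟨?_, ?_, ?_⟩ <;> split_ifs <;> simp only [map_neg, map_mul, map_sub, map_smul, a1, b1, c1, d1, a2, b2, c2]
    have both : ∀ i j c, i ≠ j → D.adj i j = false → D.adj i c = true → D.adj j c = true →
        T i (T j (EE D c)) = T j (T i (EE D c)) ∧
        T i (T j (FF D c)) = T j (T i (FF D c)) ∧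
        T i (T j (KK D c)) = T j (T i (KK D c)) := by
      intro i j c hn h hi hj
      have h' : D.adj j i = false := by rw [D.symm, h]
      have a1 : T j (EE D i) = EE D i := by rw [hE, lTE_far _ _ _ _ _ hn h']
      have b1 : T j (FF D i) = FF D i := by rw [hF, lTF_far _ _ _ _ _ hn h']
      have c1 : T j (KK D i) = KK D i := by rw [hK, lTK_far _ _ _ hn h']
      have a2 : T i (EE D j) = EE D j := by rw [hE, lTE_far _ _ _ _ _ hn.symm h]
      have b2 : T i (FF D j) = FF D j := by rw [hF, lTF_far _ _ _ _ _ hn.symm h]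
      have c2 : T i (KK D j) = KK D j := by rw [hK, lTK_far _ _ _ hn.symm h]
      have e := S.EE i j hn h
      have f := S.FF i j hn h
      have kk := S.KK i j
      have a3 := hE i c
      have a4 := hE j c
      have b3 := hF i c
      have b4 := hF j c
      have c3 := hK i c
      have c4 := hK j c
      rw [lTE_adj _ _ _ _ _ hi] at a3
      rw [lTE_adj _ _ _ _ _ hj] at a4
      rw [lTF_adj _ _ _ _ _ hi] at b3
      rw [lTF_adj _ _ _ _ _ hj] at b4
      rw [lTK_adj _ _ _ hi] at c3
      rw [lTK_adj _ _ _ hj] at c4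
      refine ⟨?_, ?_, ?_⟩
      · simp only [a3, a4, map_sub, map_smul, map_mul, a1, a2]
        exact lq_bothE e
      · simp only [b3, b4, map_sub, map_smul, map_mul, b1, b2]
        exact lq_bothF f
      · simp only [c3, c4, map_mul, c1, c2, mul_assoc, kk, lq_rs kk]
    have all : ∀ i j c, i ≠ j → D.adj i j = false →
        T i (T j (EE D c)) = T j (T i (EE D c)) ∧
        T i (T j (FF D c)) = T j (T i (FF D c)) ∧
        T i (T j (KK D c)) = T j (T i (KK D c)) := by
      intro i j c hn h
      have h' : D.adj j i = false := by rw [D.symm, h]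
      rcases lq_tri D j c with hj | hj | hj
      · obtain ⟨a, b, c⟩ := half j i c hn.symm h' (Or.inl hj)
        exact ⟨a.symm, b.symm, c.symm⟩
      · rcases lq_tri D i c with hi | hi | hi
        · exact half i j c hn h (Or.inl hi)
        · exact both i j c hn h hi hj
        · obtain ⟨a, b, c⟩ := half j i c hn.symm h' (Or.inr hi)
          exact ⟨a.symm, b.symm, c.symm⟩
      · exact half i j c hn h (Or.inr hj)
    intro i j hn h x
    have : ((T i).toAlgHom.comp (T j).toAlgHom) = ((T j).toAlgHom.comp (T i).toAlgHom) :=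
      lq_ext (fun c => (all i j c hn h).1) (fun c => (all i j c hn h).2.1) (fun c => (all i j c hn h).2.2)
    exact DFunLike.congr_fun this x
end

section
/- Fix a reduced expression i = (i_1,…,i_N) of w_0 and suppose i_k = i_{k+2} is adjacent to i_{k+1}. Then β_k + β_{k+2} = β_{k+1} and F_{i;β_{k+1}} = F_{i;β_{k+2}}F_{i;β_k} − q·F_{i;β_k}F_{i;β_{k+2}}. Moreover, for the reduced expression i′ obtained from i by replacing the subword i_k, i_{k+1}, i_k with i_{k+1}, i_k, i_{k+1}, one has F_{i′;β} = F_{i;β} for every positive root β ≠ β_{k+1}. -/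
namespace ThreeTerm

set_option linter.unusedSimpArgs false
set_option linter.unusedSectionVars false

section abstractAlg
variable {k R : Type} [Field k] [Ring R] [Algebra k R]

lemma keyF (q : k) (hq : q ≠ 0) (hq2 : q - q⁻¹ ≠ 0) (K L E F G : R) (KL : K * L = 1)
    (LK : L * K = 1) (hKF : K * F * L = (q ^ 2)⁻¹ • F) (hKG : K * G * L = q • G)
    (hEG : E * G - G * E = 0) (hEF : E * F - F * E = (q - q⁻¹)⁻¹ • (K - L)) :
    (-(L * E)) * (G * F - q • (F * G)) - q • ((G * F - q • (F * G)) * (-(L * E))) = G := by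
  have FL : F * L = (q ^ 2)⁻¹ • (L * F) := by
    calc F * L = (L * K) * F * L := by rw [LK, one_mul]
      _ = L * (K * F * L) := by simp only [mul_assoc]
      _ = _ := by rw [hKF, mul_smul_comm]
  have hGL : G * L = q • (L * G) := by
    calc G * L = (L * K) * G * L := by rw [LK, one_mul]
      _ = L * (K * G * L) := by simp only [mul_assoc]
      _ = _ := by rw [hKG, mul_smul_comm]
  have KG : K * G = q • (G * K) := by
    calc K * G = K * G * (L * K) := by rw [LK, mul_one]
      _ = (K * G * L) * K := by simp only [mul_assoc]
      _ = _ := by rw [hKG, smul_mul_assoc]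
  have GK : G * K = q⁻¹ • (K * G) := by rw [KG, smul_smul, inv_mul_cancel₀ hq, one_smul]
  have EG : E * G = G * E := sub_eq_zero.mp hEG
  have EF : E * F = F * E + (q - q⁻¹)⁻¹ • (K - L) := by rw [← hEF]; abel
  have ax : ∀ {x y z : R}, x * y = z → ∀ t, x * (y * t) = z * t := by
    intro x y z h t; rw [← mul_assoc, h]
  simp only [mul_sub, sub_mul, mul_add, add_mul, mul_assoc, neg_mul, mul_neg, smul_mul_assoc,
    mul_smul_comm, EG, ax EG, EF, ax EF, FL, ax FL, hGL, ax hGL, GK, ax GK, LK, ax LK, one_mul,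
    mul_one]
  match_scalars <;> field_simp <;> (try ring_nf)
  have hq3 : -1 + q ^ 2 ≠ 0 := by
    intro h0
    apply hq2
    field_simp
    linear_combination h0
  field_simp
  ring

lemma keyE (q : k) (hq : q ≠ 0) (hq2 : q - q⁻¹ ≠ 0) (K L E F G : R) (KL : K * L = 1)
    (LK : L * K = 1) (hKE : K * E * L = (q ^ 2) • E) (hKG : K * G * L = q⁻¹ • G)
    (hGF : G * F - F * G = 0) (hEF : E * F - F * E = (q - q⁻¹)⁻¹ • (K - L)) :
    (E * G - q⁻¹ • (G * E)) * (-(F * K)) - q⁻¹ • ((-(F * K)) * (E * G - q⁻¹ • (G * E))) = G := by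
  have KE : K * E = (q ^ 2) • (E * K) := by
    calc K * E = K * E * (L * K) := by rw [LK, mul_one]
      _ = (K * E * L) * K := by simp only [mul_assoc]
      _ = _ := by rw [hKE, smul_mul_assoc]
  have KG : K * G = q⁻¹ • (G * K) := by
    calc K * G = K * G * (L * K) := by rw [LK, mul_one]
      _ = (K * G * L) * K := by simp only [mul_assoc]
      _ = _ := by rw [hKG, smul_mul_assoc]
  have hGL : G * L = q⁻¹ • (L * G) := by
    calc G * L = (L * K) * G * L := by rw [LK, one_mul]
      _ = L * (K * G * L) := by simp only [mul_assoc]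
      _ = _ := by rw [hKG, mul_smul_comm]
  have LG : L * G = q • (G * L) := by rw [hGL, smul_smul, mul_inv_cancel₀ hq, one_smul]
  have GF : G * F = F * G := sub_eq_zero.mp hGF
  have EF : E * F = F * E + (q - q⁻¹)⁻¹ • (K - L) := by rw [← hEF]; abel
  have ax : ∀ {x y z : R}, x * y = z → ∀ t, x * (y * t) = z * t := by
    intro x y z h t; rw [← mul_assoc, h]
  simp only [mul_sub, sub_mul, mul_add, add_mul, mul_assoc, neg_mul, mul_neg, smul_mul_assoc,
    mul_smul_comm, GF, ax GF, EF, ax EF, KE, ax KE, KG, ax KG, LG, ax LG, LK, ax LK, one_mul,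
    mul_one]
  match_scalars <;> field_simp <;> (try ring_nf)
  have hq3 : -1 + q ^ 2 ≠ 0 := by
    intro h0
    apply hq2
    field_simp
    linear_combination h0
  field_simp
  ring

/-- Third vertex. -/
lemma third (q : k) (A B C : R) (h : C * B = B * C) :
    (C * A - q • (A * C)) * B - q • (B * (C * A - q • (A * C))) =
      C * (A * B - q • (B * A)) - q • ((A * B - q • (B * A)) * C) := by
  have ax : ∀ {x y z : R}, x * y = z → ∀ t, x * (y * t) = z * t := by
    intro x y z h t; rw [← mul_assoc, h]
  simp only [mul_sub, sub_mul, mul_assoc, smul_mul_assoc, mul_smul_comm, h, ax h]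
  module

lemma thirdE (q : k) (A B C : R) (h : C * B = B * C) :
    B * (A * C - q • (C * A)) - q • ((A * C - q • (C * A)) * B) =
      (B * A - q • (A * B)) * C - q • (C * (B * A - q • (A * B))) := by
  have ax : ∀ {x y z : R}, x * y = z → ∀ t, x * (y * t) = z * t := by
    intro x y z h t; rw [← mul_assoc, h]
  simp only [mul_sub, sub_mul, mul_assoc, smul_mul_assoc, mul_smul_comm, h, ax h]
  module

end abstractAlg

section Ualg
variable {I : Type} [Fintype I] [DecidableEq I] (D : ADEData I)

lemma rel {x y : FA I} (h : QRel D x y) :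
    RingQuot.mkAlgHom 𝕂 (QRel D) x = RingQuot.mkAlgHom 𝕂 (QRel D) y :=
  RingQuot.mkAlgHom_rel 𝕂 h

lemma rKL (i : I) : KK D i * KKinv D i = 1 := by
  simpa [KK, KKinv] using rel D (QRel.KKinv i)
lemma rLK (i : I) : KKinv D i * KK D i = 1 := by
  simpa [KK, KKinv] using rel D (QRel.KinvK i)
lemma rKcomm (i j : I) : KK D i * KK D j = KK D j * KK D i := by
  simpa only [KK, map_mul] using rel D (QRel.KcommK i j)
lemma rKE (i : I) : KK D i * EE D i * KKinv D i = (qq ^ 2) • EE D i := by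
  simpa only [KK, KKinv, EE, map_mul, map_smul] using rel D (QRel.KEself i)
lemma rKF (i : I) : KK D i * FF D i * KKinv D i = (qq ^ 2)⁻¹ • FF D i := by
  simpa only [KK, KKinv, FF, map_mul, map_smul] using rel D (QRel.KFself i)
lemma rKEadj (i j : I) (h : D.adj i j = true) :
    KK D i * EE D j * KKinv D i = qq⁻¹ • EE D j := by
  simpa only [KK, KKinv, EE, map_mul, map_smul] using rel D (QRel.KEadj i j h)
lemma rKFadj (i j : I) (h : D.adj i j = true) :
    KK D i * FF D j * KKinv D i = qq • FF D j := by
  simpa only [KK, KKinv, FF, map_mul, map_smul] using rel D (QRel.KFadj i j h)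
lemma rEF (i j : I) (h : i ≠ j) : EE D i * FF D j - FF D j * EE D i = 0 := by
  simpa only [EE, FF, map_mul, map_sub, map_zero] using rel D (QRel.EFdiff i j h)
lemma rEFs (i : I) : EE D i * FF D i - FF D i * EE D i =
    (qq - qq⁻¹)⁻¹ • (KK D i - KKinv D i) := by
  simpa only [EE, FF, KK, KKinv, map_mul, map_sub, map_smul] using rel D (QRel.EFself i)
lemma rEE (i j : I) (h : i ≠ j) (h' : D.adj i j = false) : EE D i * EE D j = EE D j * EE D i := by
  simpa only [EE, map_mul] using rel D (QRel.EEfar i j h h')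
lemma rFF (i j : I) (h : i ≠ j) (h' : D.adj i j = false) : FF D i * FF D j = FF D j * FF D i := by
  simpa only [FF, map_mul] using rel D (QRel.FFfar i j h h')

lemma qq_ne : qq ≠ 0 := RatFunc.X_ne_zero

lemma qq_sub_ne : qq - qq⁻¹ ≠ 0 := by
  intro h
  have h1 : qq * qq = 1 := by
    have := sub_eq_zero.mp h
    nth_rewrite 1 [this]
    exact inv_mul_cancel₀ qq_ne
  have h2 : algebraMap (Polynomial ℚ) 𝕂 (Polynomial.X * Polynomial.X) =
      algebraMap (Polynomial ℚ) 𝕂 1 := by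
    rw [map_mul, map_one, RatFunc.algebraMap_X]; exact h1
  have h3 := RatFunc.algebraMap_injective ℚ h2
  have := congrArg (Polynomial.eval 0) h3
  simp at this

lemma ne_of_adj {a b : I} (h : D.adj a b = true) : a ≠ b := by
  rintro rfl; simp [D.irrefl] at h

lemma no_triangle {a b c : I} (hab : D.adj a b = true) (hac : D.adj a c = true)
    (hbc : D.adj b c = true) : False := by
  have nab := ne_of_adj D hab
  have nac := ne_of_adj D hac
  have nbc := ne_of_adj D hbc
  have hba := hab; have hca := hac; have hcb := hbc
  rw [D.symm] at hba hca hcb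
  have := D.posdef (fun x => if x ∈ ({a, b, c} : Finset I) then 1 else 0) (by
    intro h; have := congrFun h a; simp at this)
  have e : ∀ f : I → ℚ, (∑ x, if x ∈ ({a, b, c} : Finset I) then f x else 0) = f a + f b + f c := by
    intro f
    rw [Finset.sum_ite_mem, Finset.univ_inter, Finset.sum_insert (by simp [nab, nac]),
      Finset.sum_pair nbc]
    ring
  simp only [mul_ite, mul_one, mul_zero, e] at this
  rw [Finset.sum_add_distrib, Finset.sum_add_distrib] at this
  simp only [e] at this
  norm_num [cartanOf, nab, nac, nbc, nab.symm, nac.symm, nbc.symm, hab, hac, hbc,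
    hba, hca, hcb] at this

variable {D} {T : I → (Uq D ≃ₐ[𝕂] Uq D)}

lemma TTF (hT : IsLusztigAuts D T) {a b : I} (h : D.adj a b = true) :
    T a (T b (FF D a)) = FF D b := by
  have h' : D.adj b a = true := by rw [D.symm]; exact h
  rw [(hT b a).2.1 h', map_sub, map_smul, map_mul, map_mul, (hT a b).1, (hT a b).2.1 h]
  exact keyF qq qq_ne qq_sub_ne (KK D a) (KKinv D a) (EE D a) (FF D a) (FF D b) (rKL D a)
    (rLK D a) (rKF D a) (rKFadj D a b h) (rEF D a b (ne_of_adj D h)) (rEFs D a)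

lemma TTE (hT : IsLusztigAuts D T) {a b : I} (h : D.adj a b = true) :
    T a (T b (EE D a)) = EE D b := by
  have h' : D.adj b a = true := by rw [D.symm]; exact h
  rw [(hT b a).2.2.2.2.1 h', map_sub, map_smul, map_mul, map_mul, (hT a b).2.2.2.1,
    (hT a b).2.2.2.2.1 h]
  exact keyE qq qq_ne qq_sub_ne (KK D a) (KKinv D a) (EE D a) (FF D a) (EE D b) (rKL D a)
    (rLK D a) (rKE D a) (rKEadj D a b h) (rEF D b a (ne_of_adj D h').symm.symm) (rEFs D a)

lemma TTK (hT : IsLusztigAuts D T) {a b : I} (h : D.adj a b = true) :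
    T a (T b (KK D a)) = KK D b := by
  have h' : D.adj b a = true := by rw [D.symm]; exact h
  rw [(hT b a).2.2.2.2.2.2.2.1 h', map_mul, (hT a b).2.2.2.2.2.2.1,
    (hT a b).2.2.2.2.2.2.2.1 h, rKcomm, mul_assoc, rKL, mul_one]

lemma inv_of (f : Uq D ≃ₐ[𝕂] Uq D) {i j : I} (h : f (KK D i) = KK D j) :
    f (KKinv D i) = KKinv D j := by
  have h1 : f (KKinv D i) * KK D j = 1 := by rw [← h, ← map_mul, rLK, map_one]
  calc f (KKinv D i) = f (KKinv D i) * (KK D j * KKinv D j) := by rw [rKL, mul_one]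
    _ = _ := by rw [← mul_assoc, h1, one_mul]

lemma TKinv (hT : IsLusztigAuts D T) (a : I) : T a (KKinv D a) = KK D a := by
  have h := (hT a a).2.2.2.2.2.2.1
  have h1 : T a (KKinv D a) * KKinv D a = 1 := by
    nth_rewrite 2 [← h]
    rw [← map_mul, rLK, map_one]
  calc T a (KKinv D a) = T a (KKinv D a) * (KKinv D a * KK D a) := by rw [rLK, mul_one]
    _ = _ := by rw [← mul_assoc, h1, one_mul]

/-- braid relation on an element, for composite handling -/
def Br (T : I → (Uq D ≃ₐ[𝕂] Uq D)) (a b : I) (x : Uq D) : Prop :=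
  T a (T b (T a x)) = T b (T a (T b x))

lemma Br_a (hT : IsLusztigAuts D T) {a b : I} (h : D.adj a b = true) :
    Br T a b (FF D a) ∧ Br T a b (EE D a) ∧ Br T a b (KK D a) := by
  have hK : T a (T b (KKinv D a)) = KKinv D b :=
    inv_of ((T b).trans (T a)) (TTK hT h)
  refine ⟨?_, ?_, ?_⟩
  · unfold Br
    rw [TTF hT h, (hT a a).1, (hT b b).1, map_neg, map_neg, map_mul, map_mul, hK, TTE hT h]
  · unfold Br
    rw [TTE hT h, (hT a a).2.2.2.1, (hT b b).2.2.2.1, map_neg, map_neg, map_mul, map_mul,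
      TTK hT h, TTF hT h]
  · unfold Br
    rw [TTK hT h, (hT a a).2.2.2.2.2.2.1, (hT b b).2.2.2.2.2.2.1, hK]

lemma Br_c (hT : IsLusztigAuts D T) {a b c : I} (h : D.adj a b = true) (hac : D.adj a c = true)
    (nbc : b ≠ c) (hbc : D.adj b c = false) :
    Br T a b (FF D c) ∧ Br T a b (EE D c) ∧ Br T a b (KK D c) := by
  have h' : D.adj b a = true := by rw [D.symm]; exact h
  have F1 := (hT b c).2.2.1 nbc hbc
  have E1 := (hT b c).2.2.2.2.2.1 nbc hbc
  have K1 := (hT b c).2.2.2.2.2.2.2.2 nbc hbc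
  refine ⟨?_, ?_, ?_⟩
  · unfold Br
    rw [F1, (hT a c).2.1 hac]
    simp only [map_sub, map_mul, map_smul, F1, TTF hT h]
    rw [(hT a c).2.1 hac, (hT b a).2.1 h']
    exact third qq _ _ _ (rFF D b c nbc hbc).symm
  · unfold Br
    rw [E1, (hT a c).2.2.2.2.1 hac]
    simp only [map_sub, map_mul, map_smul, E1, TTE hT h]
    rw [(hT a c).2.2.2.2.1 hac, (hT b a).2.2.2.2.1 h']
    exact thirdE qq⁻¹ _ _ _ (rEE D b c nbc hbc).symm
  · unfold Br
    rw [K1, (hT a c).2.2.2.2.2.2.2.1 hac]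
    simp only [map_mul, K1, TTK hT h]
    rw [(hT a c).2.2.2.2.2.2.2.1 hac, (hT b a).2.2.2.2.2.2.2.1 h', mul_assoc]

lemma Br_gen (hT : IsLusztigAuts D T) {a b : I} (h : D.adj a b = true) (c : I) :
    Br T a b (FF D c) ∧ Br T a b (EE D c) ∧ Br T a b (KK D c) := by
  have h' : D.adj b a = true := by rw [D.symm]; exact h
  by_cases ha : a = c
  · subst ha; exact Br_a hT h
  by_cases hb : b = c
  · subst hb
    obtain ⟨x, y, z⟩ := Br_a hT h'
    exact ⟨x.symm, y.symm, z.symm⟩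
  cases hac : D.adj a c
  · cases hbc : D.adj b c
    · have F1 := (hT b c).2.2.1 hb hbc
      have E1 := (hT b c).2.2.2.2.2.1 hb hbc
      have K1 := (hT b c).2.2.2.2.2.2.2.2 hb hbc
      have F2 := (hT a c).2.2.1 ha hac
      have E2 := (hT a c).2.2.2.2.2.1 ha hac
      have K2 := (hT a c).2.2.2.2.2.2.2.2 ha hac
      unfold Br
      refine ⟨?_, ?_, ?_⟩
      · simp only [F1, F2]
      · simp only [E1, E2]
      · simp only [K1, K2]
    · obtain ⟨x, y, z⟩ := Br_c hT h' hbc ha hac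
      exact ⟨x.symm, y.symm, z.symm⟩
  · cases hbc : D.adj b c
    · exact Br_c hT h hac hb hbc
    · exact (no_triangle D h hac hbc).elim

lemma braid (hT : IsLusztigAuts D T) {a b : I} (h : D.adj a b = true) (x : Uq D) :
    T a (T b (T a x)) = T b (T a (T b x)) := by
  let f : Uq D →ₐ[𝕂] Uq D := (((T a).trans (T b)).trans (T a)).toAlgHom
  let g : Uq D →ₐ[𝕂] Uq D := (((T b).trans (T a)).trans (T b)).toAlgHom
  suffices hfg : f = g from congrArg (fun F => F x) hfg
  apply RingQuot.ringQuot_ext'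
  apply FreeAlgebra.hom_ext
  funext s
  have hK : ∀ c, f (KK D c) = g (KK D c) := fun c => (Br_gen hT h c).2.2
  cases s with
  | E c => exact (Br_gen hT h c).2.1
  | F c => exact (Br_gen hT h c).1
  | K c => exact hK c
  | Kinv c =>
    change f (KKinv D c) = g (KKinv D c)
    calc f (KKinv D c) = f (KKinv D c) * g (KK D c * KKinv D c) := by rw [rKL, map_one, mul_one]
      _ = f (KKinv D c * KK D c) * g (KKinv D c) := by
        rw [map_mul, map_mul, ← hK, mul_assoc]
      _ = _ := by rw [rLK, map_one, one_mul]

lemma applyT_append (u v : List I) (x : Uq D) :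
    applyT T (u ++ v) x = applyT T u (applyT T v x) := by
  induction u with
  | nil => rfl
  | cons i u ih => simp [applyT, ih]

lemma applyT_sub (u : List I) (x y : Uq D) (c : 𝕂) :
    applyT T u (x * y - c • (y * x)) =
      applyT T u x * applyT T u y - c • (applyT T u y * applyT T u x) := by
  induction u with
  | nil => rfl
  | cons i u ih => simp [applyT, ih]

end Ualg

section Weyl
variable {I : Type} [Fintype I] [DecidableEq I] (D : ADEData I)

lemma cartan_symm (i j : I) : cartan D i j = cartan D j i := by
  simp only [cartan, cartanOf, eq_comm (a := i), D.symm i j]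

lemma cartan_self (i : I) : cartan D i i = 2 := by simp [cartan, cartanOf]

/-- the bilinear form -/
def bil (x y : I → ℤ) : ℤ := ∑ i, pairing D x i * y i

lemma pairing_simple (i j : I) : pairing D (simpleRoot i) j = cartan D i j := by
  simp [pairing, simpleRoot]

lemma pairing_lin (x y : I → ℤ) (c : ℤ) (i : I) :
    pairing D (x - c • y) i = pairing D x i - c * pairing D y i := by
  simp [pairing, sub_mul, Finset.sum_sub_distrib, Finset.mul_sum, mul_assoc]

lemma sref_eq (i : I) (v : I → ℤ) : sref D i v = v - pairing D v i • simpleRoot i := by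
  funext j; simp [sref]

lemma sref_lin (i : I) (x y : I → ℤ) (c : ℤ) :
    sref D i (x - c • y) = sref D i x - c • sref D i y := by
  simp only [sref_eq, pairing_lin]; module

lemma wordAct_lin (l : List I) (x y : I → ℤ) (c : ℤ) :
    wordAct D l (x - c • y) = wordAct D l x - c • wordAct D l y := by
  induction l with
  | nil => rfl
  | cons i l ih => simp only [wordAct, ih, sref_lin]

lemma sref_sref (i : I) (x : I → ℤ) : sref D i (sref D i x) = x := by
  simp only [sref_eq, pairing_lin, pairing_simple, cartan_self]; module

lemma wordAct_append (u v : List I) (x : I → ℤ) :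
    wordAct D (u ++ v) x = wordAct D u (wordAct D v x) := by
  induction u with
  | nil => rfl
  | cons i u ih => simp [wordAct, ih]

lemma wordAct_inj (l : List I) : Function.Injective (wordAct D l) := by
  induction l with
  | nil => exact fun _ _ h => h
  | cons i l ih =>
    intro x y h
    apply ih
    have := congrArg (sref D i) h
    simpa only [wordAct, sref_sref] using this

lemma bil_lin_left (x y z : I → ℤ) (c : ℤ) : bil D (x - c • y) z = bil D x z - c * bil D y z := by
  simp only [bil, pairing_lin, sub_mul, Finset.sum_sub_distrib, Finset.mul_sum, mul_assoc]

lemma bil_comm (x y : I → ℤ) : bil D x y = bil D y x := by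
  simp only [bil, pairing, Finset.sum_mul]
  rw [Finset.sum_comm]
  refine Finset.sum_congr rfl fun i _ => Finset.sum_congr rfl fun j _ => ?_
  rw [cartan_symm]; ring

lemma bil_simple (x : I → ℤ) (i : I) : bil D x (simpleRoot i) = pairing D x i := by
  simp [bil, simpleRoot]

lemma bil_sref (i : I) (x y : I → ℤ) : bil D (sref D i x) (sref D i y) = bil D x y := by
  have key : ∀ u v, bil D (sref D i u) v = bil D u v - pairing D u i * pairing D v i := by
    intro u v
    rw [sref_eq, bil_lin_left, bil_comm D (simpleRoot i), bil_simple]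
  rw [key, bil_comm, key, bil_comm, sref_eq, pairing_lin, pairing_simple, cartan_self]; ring

lemma bil_wordAct (l : List I) (x y : I → ℤ) : bil D (wordAct D l x) (wordAct D l y) = bil D x y := by
  induction l with
  | nil => rfl
  | cons i l ih => simp only [wordAct, bil_sref, ih]

lemma cancel (v : List I) (i j : I) (h : simpleRoot i = wordAct D (i :: v) (simpleRoot j))
    (x : I → ℤ) : wordAct D (i :: v) (sref D j x) = wordAct D v x := by
  have h2 : wordAct D (i :: v) (sref D j x) =
      wordAct D (i :: v) x - pairing D x j • simpleRoot i := by
    rw [sref_eq, wordAct_lin, ← h]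
  have h3 : pairing D x j = pairing D (wordAct D (i :: v) x) i := by
    rw [← bil_simple, ← bil_simple, h, bil_wordAct]
  rw [h2, h3, ← sref_eq, wordAct, sref_sref]

lemma beta_mk (u v : List I) (i : I) (h : u.length < (u ++ i :: v).length) :
    beta D (u ++ i :: v) ⟨u.length, h⟩ = wordAct D u (simpleRoot i) := by
  simp [beta]

lemma rootVec_mk {D : ADEData I} (T : I → (Uq D ≃ₐ[𝕂] Uq D)) (u v : List I) (i : I)
    (h : u.length < (u ++ i :: v).length) :
    rootVec T (u ++ i :: v) ⟨u.length, h⟩ = applyT T u (FF D i) := by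
  simp [rootVec]

lemma beta_mk' {w u v : List I} {i : I} (e : w = u ++ i :: v) (n : ℕ) (hn : n = u.length)
    (h : n < w.length) : beta D w ⟨n, h⟩ = wordAct D u (simpleRoot i) := by
  subst e hn; exact beta_mk D u v i h

lemma rootVec_mk' {D : ADEData I} (T : I → (Uq D ≃ₐ[𝕂] Uq D)) {w u v : List I} {i : I}
    (e : w = u ++ i :: v) (n : ℕ) (hn : n = u.length) (h : n < w.length) :
    rootVec T w ⟨n, h⟩ = applyT T u (FF D i) := by
  subst e hn; exact rootVec_mk T u v i h

lemma split (w : List I) (n : ℕ) (h : n < w.length) :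
    ∃ u i v, w = u ++ i :: v ∧ n = u.length :=
  ⟨w.take n, w[n], w.drop (n + 1), by simp, by simp; omega⟩

lemma beta_ne (w : List I) (hw : IsReducedWord D w) (m n : ℕ) (hmn : m < n) (hn : n < w.length) :
    beta D w ⟨m, by omega⟩ ≠ beta D w ⟨n, hn⟩ := by
  intro heq
  obtain ⟨u, i, r, rfl, rfl⟩ := split w m (by omega)
  obtain ⟨v, j, x, rfl, hv⟩ := split r (n - u.length - 1) (by simp at hn; omega)
  rw [beta_mk' D rfl _ rfl,
    beta_mk' D (u := u ++ i :: v) (i := j) (v := x) (by simp) n (by simp; omega),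
    wordAct_append] at heq
  have h1 := wordAct_inj D u heq
  have := hw (u ++ v ++ x) (by
    funext y
    have := cancel D v i j h1 (wordAct D x y)
    simp only [wordAct, wordAct_append] at this ⊢
    rw [this])
  simp at this

lemma beta_inj (w : List I) (hw : IsReducedWord D w) (m n : Fin w.length)
    (h : beta D w m = beta D w n) : m = n := by
  rcases lt_trichotomy m n with h1 | h1 | h1
  · exact (beta_ne D w hw m n h1 n.2 h).elim
  · exact h1
  · exact (beta_ne D w hw n m h1 m.2 h.symm).elim

lemma sref_adj {a b : I} (h : D.adj a b = true) :
    sref D a (simpleRoot b) = simpleRoot b - (-1 : ℤ) • simpleRoot a := by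
  have hba : D.adj b a = true := by rw [D.symm]; exact h
  have : cartan D b a = -1 := by simp [cartan, cartanOf, hba, (ne_of_adj D h).symm]
  rw [sref_eq, pairing_simple, this]

lemma ss_adj {a b : I} (h : D.adj a b = true) :
    sref D a (sref D b (simpleRoot a)) = simpleRoot b := by
  have hba : D.adj b a = true := by rw [D.symm]; exact h
  rw [sref_adj D hba, sref_lin, sref_adj D h, sref_eq, pairing_simple, cartan_self]; module

lemma sref_braid {a b : I} (h : D.adj a b = true) (x : I → ℤ) :
    sref D a (sref D b (sref D a x)) = sref D b (sref D a (sref D b x)) := by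
  have hba : D.adj b a = true := by rw [D.symm]; exact h
  have h1 : cartan D b a = -1 := by simp [cartan, cartanOf, hba, (ne_of_adj D h).symm]
  have h2 : cartan D a b = -1 := by simp [cartan, cartanOf, h, (ne_of_adj D h)]
  simp only [sref_eq, pairing_lin, pairing_simple, cartan_self, h1, h2]; module

end Weyl

end ThreeTerm

/-- For a three-term braid move at position `k` (so
`i_k = i_{k+2}` is adjacent to `i_{k+1}`): `β_k + β_{k+2} = β_{k+1}`,
`F_{β_{k+1}} = F_{β_{k+2}} F_{β_k} - q F_{β_k} F_{β_{k+2}}`, the moved word is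
again a reduced expression of `w₀`, and the root vector of every root other
than `β_{k+1}` is unchanged. -/
theorem three_term_braid_move_root_vectors
    {I : Type} [Fintype I] [DecidableEq I] (D : ADEData I)
    (T : I → (Uq D ≃ₐ[𝕂] Uq D)) (hT : IsLusztigAuts D T)
    (w w' : List I) (hw : IsRedW0 D w)
    (w₁ w₂ : List I) (a b : I) (hadj : D.adj a b = true)
    (hdec : w = w₁ ++ a :: b :: a :: w₂) (hdec' : w' = w₁ ++ b :: a :: b :: w₂)
    (h2 : w₁.length + 2 < w.length) :
    (beta D w ⟨w₁.length, by omega⟩ + beta D w ⟨w₁.length + 2, h2⟩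
        = beta D w ⟨w₁.length + 1, by omega⟩) ∧
    (rootVec T w ⟨w₁.length + 1, by omega⟩ =
      rootVec T w ⟨w₁.length + 2, h2⟩ * rootVec T w ⟨w₁.length, by omega⟩
        - qq • (rootVec T w ⟨w₁.length, by omega⟩ *
            rootVec T w ⟨w₁.length + 2, h2⟩)) ∧
    IsRedW0 D w' ∧
    (∀ (k : Fin w.length) (k' : Fin w'.length),
      beta D w k = beta D w' k' →
      beta D w k ≠ beta D w ⟨w₁.length + 1, by omega⟩ →
      rootVec T w k = rootVec T w' k') := by
  have hba : D.adj b a = true := by rw [D.symm]; exact hadj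
  have e0 : w = w₁ ++ a :: (b :: a :: w₂) := hdec
  have e1 : w = (w₁ ++ [a]) ++ b :: (a :: w₂) := by simp [hdec]
  have e2 : w = (w₁ ++ [a, b]) ++ a :: w₂ := by simp [hdec]
  have e0' : w' = w₁ ++ b :: (a :: b :: w₂) := hdec'
  have e1' : w' = (w₁ ++ [b]) ++ a :: (b :: w₂) := by simp [hdec']
  have e2' : w' = (w₁ ++ [b, a]) ++ b :: w₂ := by simp [hdec']
  have hlen : w'.length = w.length := by simp [hdec, hdec']
  have l1 : ∀ c : I, w₁.length + 1 = (w₁ ++ [c]).length := fun c => by simp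
  have l2 : ∀ c d : I, w₁.length + 2 = (w₁ ++ [c, d]).length := fun c d => by simp
  have hact : wordAct D w' = wordAct D w := by
    funext x
    rw [hdec, hdec', ThreeTerm.wordAct_append, ThreeTerm.wordAct_append]
    simp only [wordAct]
    rw [ThreeTerm.sref_braid D hadj]
  have B0 := ThreeTerm.beta_mk' D e0 w₁.length rfl (by omega)
  have B1 := ThreeTerm.beta_mk' D e1 (w₁.length + 1) (l1 _) (by omega)
  have B2 := ThreeTerm.beta_mk' D e2 (w₁.length + 2) (l2 _ _) (by omega)
  have R0 := ThreeTerm.rootVec_mk' T e0 w₁.length rfl (by omega)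
  have R1 := ThreeTerm.rootVec_mk' T e1 (w₁.length + 1) (l1 _) (by omega)
  have R2 := ThreeTerm.rootVec_mk' T e2 (w₁.length + 2) (l2 _ _) (by omega)
  have B0' := ThreeTerm.beta_mk' D e0' w₁.length rfl (by omega)
  have B1' := ThreeTerm.beta_mk' D e1' (w₁.length + 1) (l1 _) (by omega)
  have B2' := ThreeTerm.beta_mk' D e2' (w₁.length + 2) (l2 _ _) (by omega)
  have R0' := ThreeTerm.rootVec_mk' T e0' w₁.length rfl (by omega)
  have R2' := ThreeTerm.rootVec_mk' T e2' (w₁.length + 2) (l2 _ _) (by omega)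
  rw [ThreeTerm.wordAct_append] at B1 B2 B1' B2'
  rw [ThreeTerm.applyT_append] at R1 R2 R2'
  simp only [wordAct] at B1 B2 B1' B2'
  simp only [applyT] at R1 R2 R2'
  rw [ThreeTerm.TTF hT hadj] at R2
  rw [ThreeTerm.TTF hT hba] at R2'
  rw [ThreeTerm.ss_adj D hadj] at B2
  rw [ThreeTerm.ss_adj D hba] at B2'
  rw [ThreeTerm.sref_adj D hadj] at B1
  rw [ThreeTerm.sref_adj D hba] at B1'
  rw [(hT a b).2.1 hadj, ThreeTerm.applyT_sub] at R1
  refine ⟨?_, ?_, ⟨?_, ?_⟩, ?_⟩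
  · rw [B0, B1, B2, ThreeTerm.wordAct_lin]; module
  · rw [R0, R1, R2]
  · intro v hv
    rw [hlen]; exact hw.1 v (hv.trans hact)
  · intro v hv
    rw [hlen]; exact hw.2 v hv
  · intro k k' hkk hk
    suffices hs : ∃ l : Fin w.length, beta D w l = beta D w' k' ∧
        (rootVec T w l = rootVec T w' k' ∨ l = ⟨w₁.length + 1, by omega⟩) by
      obtain ⟨l, hl, hr⟩ := hs
      have hkl : k = l := ThreeTerm.beta_inj D w hw.1 k l (hkk.trans hl.symm)
      subst hkl
      rcases hr with hr | hr
      · exact hr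
      · rw [hr] at hk; exact (hk rfl).elim
    obtain ⟨n, hn⟩ := k'
    by_cases c0 : n < w₁.length
    · obtain ⟨u, i, v, e, hu⟩ := ThreeTerm.split w₁ n c0
      have f : w = u ++ i :: (v ++ a :: b :: a :: w₂) := by simp [hdec, e]
      have f' : w' = u ++ i :: (v ++ b :: a :: b :: w₂) := by simp [hdec', e]
      refine ⟨⟨n, by omega⟩, ?_, Or.inl ?_⟩
      · rw [ThreeTerm.beta_mk' D f n hu, ThreeTerm.beta_mk' D f' n hu]
      · rw [ThreeTerm.rootVec_mk' T f n hu, ThreeTerm.rootVec_mk' T f' n hu]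
    by_cases c1 : n = w₁.length
    · subst c1
      exact ⟨⟨w₁.length + 2, h2⟩, by rw [B2, B0'], Or.inl (by rw [R2, R0'])⟩
    by_cases c2 : n = w₁.length + 1
    · subst c2
      refine ⟨⟨w₁.length + 1, by omega⟩, ?_, Or.inr rfl⟩
      rw [B1, B1']; congr 1; module
    by_cases c3 : n = w₁.length + 2
    · subst c3
      exact ⟨⟨w₁.length, by omega⟩, by rw [B0, B2'], Or.inl (by rw [R0, R2'])⟩
    have hl : w'.length = w₁.length + (w₂.length + 3) := by simp [hdec']
    obtain ⟨u, i, v, e, hu⟩ := ThreeTerm.split w₂ (n - w₁.length - 3) (by omega)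
    have f : w = (w₁ ++ a :: b :: a :: u) ++ i :: v := by simp [hdec, e]
    have f' : w' = (w₁ ++ b :: a :: b :: u) ++ i :: v := by simp [hdec', e]
    have g : n = (w₁ ++ a :: b :: a :: u).length := by simp; omega
    have g' : n = (w₁ ++ b :: a :: b :: u).length := by simp; omega
    refine ⟨⟨n, by omega⟩, ?_, Or.inl ?_⟩
    · rw [ThreeTerm.beta_mk' D f n g, ThreeTerm.beta_mk' D f' n g', ThreeTerm.wordAct_append,
        ThreeTerm.wordAct_append]
      simp only [wordAct]
      rw [ThreeTerm.sref_braid D hadj]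
    · rw [ThreeTerm.rootVec_mk' T f n g, ThreeTerm.rootVec_mk' T f' n g',
        ThreeTerm.applyT_append, ThreeTerm.applyT_append]
      simp only [applyT]
      rw [ThreeTerm.braid hT hadj]
end

section
/- Fix a reduced expression i = (i_1,…,i_N) of w_0 with associated ordered list of positive roots β_1,…,β_N, where β_k = s_{i_1}⋯s_{i_{k-1}}(α_{i_k}). Fix 1 ≤ j < k ≤ N. If n·β_ℓ = a_j β_j + a_{j+1}β_{j+1} + ⋯ + a_k β_k with integers n, a_j, a_k > 0 and a_{j+1},…,a_{k-1} ≥ 0, then j < ℓ < k. -/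
section ConvexityAux

variable {I : Type} [Fintype I] [DecidableEq I]

/-- bilinear form -/
def bil (D : ADEData I) (u v : I → ℤ) : ℤ := ∑ i, ∑ j, cartan D i j * u i * v j

lemma cartan_symm (D : ADEData I) (i j : I) : cartan D i j = cartan D j i := by
  unfold cartan cartanOf
  rw [D.symm i j]
  simp only [eq_comm]

lemma bil_symm (D : ADEData I) (u v : I → ℤ) : bil D u v = bil D v u := by
  unfold bil
  rw [Finset.sum_comm]
  refine Finset.sum_congr rfl fun i _ => Finset.sum_congr rfl fun j _ => ?_
  rw [cartan_symm D j i]; ring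

lemma bil_add_left (D : ADEData I) (u v x : I → ℤ) : bil D (u + v) x = bil D u x + bil D v x := by
  unfold bil
  simp only [← Finset.sum_add_distrib]
  refine Finset.sum_congr rfl fun i _ => Finset.sum_congr rfl fun j _ => ?_
  simp only [Pi.add_apply]; ring

lemma bil_smul_left (D : ADEData I) (c : ℤ) (v x : I → ℤ) : bil D (c • v) x = c * bil D v x := by
  unfold bil
  simp only [Finset.mul_sum]
  refine Finset.sum_congr rfl fun i _ => Finset.sum_congr rfl fun j _ => ?_
  simp only [Pi.smul_apply, smul_eq_mul]; ring

lemma bil_add_right (D : ADEData I) (u v x : I → ℤ) : bil D x (u + v) = bil D x u + bil D x v := by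
  rw [bil_symm, bil_add_left, bil_symm D u, bil_symm D v]

lemma bil_smul_right (D : ADEData I) (c : ℤ) (v x : I → ℤ) : bil D x (c • v) = c * bil D x v := by
  rw [bil_symm, bil_smul_left, bil_symm D v]

lemma pairing_eq (D : ADEData I) (v : I → ℤ) (i : I) : pairing D v i = bil D v (simpleRoot i) := by
  unfold pairing bil simpleRoot
  refine Finset.sum_congr rfl fun j _ => ?_
  simp [mul_comm]

lemma bil_simple (D : ADEData I) (i : I) : bil D (simpleRoot i) (simpleRoot i) = 2 := by
  unfold bil simpleRoot
  simp [cartan, cartanOf]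

lemma sref_eq (D : ADEData I) (i : I) (v : I → ℤ) :
    sref D i v = v + (-(bil D v (simpleRoot i))) • simpleRoot i := by
  ext j
  simp [sref, pairing_eq]; ring

lemma bil_sref (D : ADEData I) (i : I) (u v : I → ℤ) :
    bil D (sref D i u) (sref D i v) = bil D u v := by
  simp only [sref_eq, bil_add_left, bil_add_right, bil_smul_left, bil_smul_right, bil_simple]
  rw [bil_symm D (simpleRoot i) v]; ring

lemma sref_sref (D : ADEData I) (i : I) (v : I → ℤ) : sref D i (sref D i v) = v := by
  ext j
  simp only [sref_eq, bil_add_left, bil_smul_left, bil_simple, Pi.add_apply, Pi.smul_apply,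
    smul_eq_mul]
  ring

lemma sref_simple (D : ADEData I) (i : I) : sref D i (simpleRoot i) = - simpleRoot i := by
  ext j
  simp only [sref_eq, bil_simple, Pi.add_apply, Pi.smul_apply, smul_eq_mul, Pi.neg_apply]
  ring

lemma sref_add (D : ADEData I) (i : I) (u v : I → ℤ) :
    sref D i (u + v) = sref D i u + sref D i v := by
  ext j
  simp only [sref_eq, bil_add_left, Pi.add_apply, Pi.smul_apply, smul_eq_mul]
  ring

lemma sref_smul (D : ADEData I) (i : I) (c : ℤ) (v : I → ℤ) :
    sref D i (c • v) = c • sref D i v := by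
  ext j
  simp only [sref_eq, bil_smul_left, Pi.add_apply, Pi.smul_apply, smul_eq_mul]
  ring

lemma wordAct_add (D : ADEData I) (l : List I) (u v : I → ℤ) :
    wordAct D l (u + v) = wordAct D l u + wordAct D l v := by
  induction l with
  | nil => rfl
  | cons i l ih => simp only [wordAct, ih, sref_add]

lemma wordAct_smul (D : ADEData I) (l : List I) (c : ℤ) (v : I → ℤ) :
    wordAct D l (c • v) = c • wordAct D l v := by
  induction l with
  | nil => rfl
  | cons i l ih => simp only [wordAct, ih, sref_smul]

/-- The action as a linear map. -/
def wordLin (D : ADEData I) (l : List I) : (I → ℤ) →ₗ[ℤ] (I → ℤ) where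
  toFun := wordAct D l
  map_add' := wordAct_add D l
  map_smul' := wordAct_smul D l

lemma wordAct_neg (D : ADEData I) (l : List I) (v : I → ℤ) :
    wordAct D l (-v) = - wordAct D l v := (wordLin D l).map_neg v

lemma bil_wordAct (D : ADEData I) (l : List I) (u v : I → ℤ) :
    bil D (wordAct D l u) (wordAct D l v) = bil D u v := by
  induction l with
  | nil => rfl
  | cons i l ih => simp only [wordAct, bil_sref, ih]

lemma wordAct_append (D : ADEData I) (l l' : List I) (v : I → ℤ) :
    wordAct D (l ++ l') v = wordAct D l (wordAct D l' v) := by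
  induction l with
  | nil => rfl
  | cons i l ih => simp only [List.cons_append, wordAct, ih]

lemma wordAct_reverse (D : ADEData I) (l : List I) (v : I → ℤ) :
    wordAct D l.reverse (wordAct D l v) = v := by
  induction l with
  | nil => rfl
  | cons i l ih => simp only [List.reverse_cons, wordAct_append, wordAct, sref_sref, ih]

lemma wordAct_reverse' (D : ADEData I) (l : List I) (v : I → ℤ) :
    wordAct D l (wordAct D l.reverse v) = v := by
  simpa using wordAct_reverse D l.reverse v

lemma bil_pos (D : ADEData I) (v : I → ℤ) (hv : v ≠ 0) : 0 < bil D v v := by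
  have h := D.posdef (fun i => (v i : ℚ)) (by
    intro h; apply hv; ext i; have := congrFun h i; simpa using this)
  have e : ((bil D v v : ℤ) : ℚ) =
      ∑ i, ∑ j, (cartanOf D.adj i j : ℚ) * (v i : ℚ) * (v j : ℚ) := by
    unfold bil cartan; push_cast; rfl
  rw [← e] at h
  exact_mod_cast h

/-- `wordAct` in a different shape: vectors of norm 2 have constant sign. -/
lemma bil_even (D : ADEData I) (v : I → ℤ) : Even (bil D v v) := by
  suffices H : ∀ s : Finset I, Even (∑ i ∈ s, ∑ j ∈ s, cartan D i j * v i * v j) from H _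
  intro s
  induction s using Finset.induction_on with
  | empty => simp
  | insert a s ha ih =>
    rw [Finset.sum_insert ha, Finset.sum_insert ha]
    simp only [Finset.sum_insert ha, Finset.sum_add_distrib]
    have e : ∑ i ∈ s, cartan D i a * v i * v a = ∑ j ∈ s, cartan D a j * v a * v j :=
      Finset.sum_congr rfl fun i _ => by rw [cartan_symm D i a]; ring
    rw [e]
    have h2 : cartan D a a = 2 := by simp [cartan, cartanOf]
    rw [h2]
    obtain ⟨r, hr⟩ := ih
    rw [hr]
    exact ⟨v a * v a + (∑ j ∈ s, cartan D a j * v a * v j) + r, by ring⟩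

lemma bil_ge_two (D : ADEData I) (v : I → ℤ) (hv : v ≠ 0) : 2 ≤ bil D v v := by
  have h := bil_pos D v hv
  obtain ⟨r, hr⟩ := bil_even D v
  omega

lemma sign_of_norm_two (D : ADEData I) (v : I → ℤ) (hv : bil D v v = 2) : 0 ≤ v ∨ v ≤ 0 := by
  set p : I → ℤ := fun i => max (v i) 0 with hp
  set m : I → ℤ := fun i => max (-(v i)) 0 with hm
  have e : v = p + (-1 : ℤ) • m := by
    ext i; simp only [hp, hm, Pi.add_apply, Pi.smul_apply, smul_eq_mul]; grind
  have hpm : bil D p m ≤ 0 := by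
    unfold bil
    refine Finset.sum_nonpos fun i _ => Finset.sum_nonpos fun j _ => ?_
    by_cases hij : i = j
    · subst hij
      have : p i * m i = 0 := by
        simp only [hp, hm]
        rcases le_total (v i) 0 with h | h
        · rw [max_eq_right h]; simp
        · rw [max_eq_right (a := -(v i)) (by omega)]; simp
      rw [mul_assoc, this]; simp
    · have hc : cartan D i j ≤ 0 := by
        simp only [cartan, cartanOf, if_neg hij]; split_ifs <;> simp
      rw [mul_assoc]
      exact mul_nonpos_of_nonpos_of_nonneg hc (mul_nonneg (le_max_right _ _) (le_max_right _ _))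
  have hn : bil D v v = bil D p p + bil D m m - 2 * bil D p m := by
    rw [e]
    simp only [bil_add_left, bil_add_right, bil_smul_left, bil_smul_right]
    rw [bil_symm D m p]; ring
  by_cases h1 : p = 0
  · right; intro i
    have := congrFun h1 i
    simp only [hp, Pi.zero_apply] at this ⊢
    have := le_max_left (v i) 0
    omega
  · by_cases h2 : m = 0
    · left; intro i
      have := congrFun h2 i
      simp only [hm, Pi.zero_apply] at this ⊢
      have := le_max_left (-(v i)) 0
      omega
    · have := bil_ge_two D p h1
      have := bil_ge_two D m h2
      omega

lemma eq_simple_of (D : ADEData I) (i : I) (v : I → ℤ) (hv : bil D v v = 2) (h0 : 0 ≤ v)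
    (hs : ¬ 0 ≤ sref D i v) : v = simpleRoot i := by
  have hneg := (sign_of_norm_two D (sref D i v) (by rw [bil_sref, hv])).resolve_left hs
  have hj : ∀ j, j ≠ i → v j = 0 := by
    intro j hji
    have h1 := hneg j
    have h2 := h0 j
    simp only [sref, simpleRoot, if_neg hji, Pi.zero_apply] at h1 h2
    omega
  have e : v = (v i) • simpleRoot i := by
    ext j
    by_cases h : j = i
    · subst h; simp [simpleRoot]
    · simp [simpleRoot, h, hj j h]
  have hi : 0 ≤ v i := h0 i
  rw [e, bil_smul_left, bil_smul_right, bil_simple] at hv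
  have : v i = 1 := by nlinarith
  rw [e, this, one_smul]

lemma simple_nonneg (i : I) : (0 : I → ℤ) ≤ simpleRoot i := by
  intro j; simp only [simpleRoot, Pi.zero_apply]; split_ifs <;> simp

lemma reduced_mid (D : ADEData I) (a b c : List I) (h : IsReducedWord D (a ++ b ++ c)) :
    IsReducedWord D b := by
  intro w' hw'
  have := h (a ++ w' ++ c) (by funext v; simp only [wordAct_append, hw'])
  simp only [List.length_append] at this
  omega

lemma reduced_reverse (D : ADEData I) (b : List I) (h : IsReducedWord D b) :
    IsReducedWord D b.reverse := by
  intro w' hw'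
  have := h w'.reverse (by
    funext v
    have h1 := wordAct_reverse D w' (wordAct D b v)
    rw [hw', wordAct_reverse] at h1
    exact h1)
  simpa using this

lemma reduced_nonneg (D : ADEData I) (u : List I) (i : I) (h : IsReducedWord D (u ++ [i])) :
    0 ≤ wordAct D u (simpleRoot i) := by
  induction u with
  | nil => exact simple_nonneg i
  | cons t u ih =>
    have h0 := ih (reduced_mid D [t] (u ++ [i]) [] (by simpa using h))
    by_contra hs
    have e := eq_simple_of D t _ (by rw [bil_wordAct, bil_simple]) h0 hs
    have := h u (by
      funext v
      simp only [List.cons_append, wordAct, wordAct_append]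
      rw [sref_eq D i v, wordAct_add, wordAct_smul, sref_add, sref_smul, e, sref_simple,
        sref_eq D t (wordAct D u v), ← e, bil_wordAct]
      ext j
      simp only [Pi.add_apply, Pi.smul_apply, smul_eq_mul, Pi.neg_apply]
      ring)
    simp at this

lemma reduced_pos (D : ADEData I) (u : List I) (i : I) (h : IsReducedWord D (u ++ [i])) :
    0 < wordAct D u (simpleRoot i) := by
  refine lt_of_le_of_ne (reduced_nonneg D u i h) fun h0 => ?_
  have := bil_wordAct D u (simpleRoot i) (simpleRoot i)
  rw [← h0, bil_simple] at this
  simp [bil] at this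

lemma beta_pos (D : ADEData I) (w : List I) (hw : IsReducedWord D w) (m : ℕ) (k : Fin w.length)
    (hmk : m ≤ k) : 0 < wordLin D (w.take m).reverse (beta D w k) := by
  have e : w.take k = w.take m ++ (w.take k).drop m := by
    conv_lhs => rw [← List.take_append_drop m (w.take k)]
    rw [List.take_take, min_eq_left hmk]
  change 0 < wordAct D _ (beta D w k)
  unfold beta
  rw [e, wordAct_append, wordAct_reverse]
  apply reduced_pos
  apply reduced_mid D (w.take m) _ (w.drop (k + 1))
  rw [← List.append_assoc, ← e]
  have : w.take k ++ [w.get k] = w.take (k + 1) := by simp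
  rw [this, List.take_append_drop]
  exact hw

lemma beta_neg (D : ADEData I) (w : List I) (hw : IsReducedWord D w) (m : ℕ) (k : Fin w.length)
    (hkm : (k : ℕ) < m) : wordLin D (w.take m).reverse (beta D w k) < 0 := by
  have t : w.take k ++ [w.get k] = w.take (k + 1) := by simp
  have e : w.take m = w.take k ++ ([w.get k] ++ (w.take m).drop (k + 1)) := by
    rw [← List.append_assoc, t]
    conv_lhs => rw [← List.take_append_drop (k + 1) (w.take m)]
    rw [List.take_take, min_eq_left (by omega)]
  change wordAct D _ (beta D w k) < 0
  unfold beta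
  generalize hd : (w.take m).drop (k + 1) = d at e
  rw [e, List.reverse_append, wordAct_append, wordAct_reverse, List.reverse_append,
    wordAct_append]
  have : wordAct D [w.get k].reverse (simpleRoot (w.get k)) = - simpleRoot (w.get k) := by
    simp only [List.reverse_singleton, wordAct, sref_simple]
  rw [this, wordAct_neg, neg_lt_zero]
  apply reduced_pos
  have := reduced_reverse D ([w.get k] ++ d) (reduced_mid D (w.take k) _ (w.drop m) (by
    rw [← e, List.take_append_drop]; exact hw))
  simpa using this

end ConvexityAux

/-- (Convexity of the root order.) If `j < k` and
`n β_ℓ = a_j β_j + ⋯ + a_k β_k` with `n, a_j, a_k > 0` and the intermediate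
coefficients non-negative, then `j < ℓ < k`. -/
theorem convexity_of_beta_order
    {I : Type} [Fintype I] [DecidableEq I] (D : ADEData I)
    (w : List I) (hw : IsRedW0 D w)
    (j k l : Fin w.length) (hjk : j < k)
    (n : ℕ) (hn : 0 < n) (a : Fin w.length → ℕ) (haj : 0 < a j) (hak : 0 < a k)
    (heq : (n : ℤ) • beta D w l = ∑ m ∈ Finset.Icc j k, (a m : ℤ) • beta D w m) :
    j < l ∧ l < k := by
  have hr := hw.1
  have hn' : (0 : ℤ) < n := by exact_mod_cast hn
  have haj' : (0 : ℤ) < a j := by exact_mod_cast haj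
  have hak' : (0 : ℤ) < a k := by exact_mod_cast hak
  have hapos : ∀ m, (0 : ℤ) ≤ a m := fun m => by positivity
  have P := beta_pos D w hr
  have N := beta_neg D w hr
  have sp : ∀ (f : (I → ℤ) →ₗ[ℤ] (I → ℤ)) (s : Finset (Fin w.length)) (t : Fin w.length),
      t ∈ s → 0 < (a t : ℤ) → (∀ m ∈ s, 0 < f (beta D w m)) →
      0 < f (∑ m ∈ s, (a m : ℤ) • beta D w m) := by
    intro f s t ht hat hf
    rw [map_sum]
    refine Finset.sum_pos' (fun m hm => ?_) ⟨t, ht, ?_⟩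
    · rw [map_smul]; exact smul_nonneg (hapos m) (hf m hm).le
    · rw [map_smul]; exact smul_pos hat (hf t ht)
  have sn : ∀ (f : (I → ℤ) →ₗ[ℤ] (I → ℤ)) (s : Finset (Fin w.length)) (t : Fin w.length),
      t ∈ s → 0 < (a t : ℤ) → (∀ m ∈ s, f (beta D w m) < 0) →
      f (∑ m ∈ s, (a m : ℤ) • beta D w m) < 0 := by
    intro f s t ht hat hf
    have := sp (-f) s t ht hat (fun m hm => by simpa using hf m hm)
    simpa using this
  have hjk' : (j : ℕ) < k := hjk
  have memj : j ∈ Finset.Icc j k := by simp [hjk.le]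
  have memk : k ∈ Finset.Icc j k := by simp [hjk.le]
  constructor
  · by_contra hlj
    rcases lt_or_eq_of_le (not_lt.mp hlj) with h | h
    · have h' : (l : ℕ) < j := h
      have h1 := sp (wordLin D (w.take (l + 1)).reverse) _ j memj haj' (fun m hm => P _ m (by
        have : (j : ℕ) ≤ m := (Finset.mem_Icc.mp hm).1
        omega))
      rw [← heq, map_smul] at h1
      exact absurd h1 (not_lt_of_ge (smul_nonpos_of_nonneg_of_nonpos hn'.le (N _ l (by omega)).le))
    · subst h
      have hs := Finset.add_sum_erase (Finset.Icc l k) (fun m => (a m : ℤ) • beta D w m) memj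
      have heq2 : ((n : ℤ) - a l) • beta D w l
          = ∑ m ∈ (Finset.Icc l k).erase l, (a m : ℤ) • beta D w m := by
        rw [sub_smul, heq, ← hs]; simp
      have memk' : k ∈ (Finset.Icc l k).erase l := by simp [hjk, hjk.le, hjk.ne']
      have hlt : ∀ m ∈ (Finset.Icc l k).erase l, (l : ℕ) < m := by
        intro m hm
        simp only [Finset.mem_erase, Finset.mem_Icc] at hm
        exact lt_of_le_of_ne hm.2.1 fun h => hm.1 (Fin.ext h.symm)
      rcases le_total (0 : ℤ) ((n : ℤ) - a l) with h | h
      · have h1 := sp (wordLin D (w.take (l + 1)).reverse) _ k memk' hak'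
          (fun m hm => P _ m (hlt m hm))
        rw [← heq2, map_smul] at h1
        exact absurd h1 (not_lt_of_ge (smul_nonpos_of_nonneg_of_nonpos h (N _ l (by omega)).le))
      · have h1 := sp (wordLin D (w.take 0).reverse) _ k memk' hak'
          (fun m hm => P _ m (Nat.zero_le _))
        rw [← heq2, map_smul] at h1
        exact absurd h1 (not_lt_of_ge (smul_nonpos_of_nonpos_of_nonneg h (P _ l (Nat.zero_le _)).le))
  · by_contra hlj
    rcases lt_or_eq_of_le (not_lt.mp hlj) with h | h
    · have h' : (k : ℕ) < l := h
      have h1 := sn (wordLin D (w.take l).reverse) _ j memj haj' (fun m hm => N _ m (by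
        have : (m : ℕ) ≤ k := (Finset.mem_Icc.mp hm).2
        omega))
      rw [← heq, map_smul] at h1
      exact absurd h1 (not_lt_of_ge (smul_nonneg hn'.le (P _ l le_rfl).le))
    · subst h
      have hs := Finset.add_sum_erase (Finset.Icc j k) (fun m => (a m : ℤ) • beta D w m) memk
      have heq2 : ((n : ℤ) - a k) • beta D w k
          = ∑ m ∈ (Finset.Icc j k).erase k, (a m : ℤ) • beta D w m := by
        rw [sub_smul, heq, ← hs]; simp
      have memj' : j ∈ (Finset.Icc j k).erase k := by simp [hjk, hjk.le, hjk.ne]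
      have hlt : ∀ m ∈ (Finset.Icc j k).erase k, (m : ℕ) < k := by
        intro m hm
        simp only [Finset.mem_erase, Finset.mem_Icc] at hm
        exact lt_of_le_of_ne hm.2.2 fun h => hm.1 (Fin.ext h)
      rcases le_total (0 : ℤ) ((n : ℤ) - a k) with h | h
      · have h1 := sn (wordLin D (w.take k).reverse) _ j memj' haj'
          (fun m hm => N _ m (hlt m hm))
        rw [← heq2, map_smul] at h1
        exact absurd h1 (not_lt_of_ge (smul_nonneg h (P _ k le_rfl).le))
      · have h1 := sp (wordLin D (w.take 0).reverse) _ j memj' haj'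
          (fun m hm => P _ m (Nat.zero_le _))
        rw [← heq2, map_smul] at h1
        exact absurd h1 (not_lt_of_ge (smul_nonpos_of_nonpos_of_nonneg h (P _ k (Nat.zero_le _)).le))
end
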